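/- arXiv:0909.1867 — 2 statements merged into one kernel-verified Lean document; each statement's English description precedes it below -/
import Mathlib

section
/- Every bounded derivation D from the disc algebra A(𝔻) to its dual A(𝔻)* is a compact operator. -/
open Complex MeasureTheory Metric Real

set_option synthInstance.maxHeartbeats 400000
set_option maxHeartbeats 1000000

noncomputable section

/-- The closed unit disc `Δ ⊆ ℂ`. -/
abbrev closedDisc : Set ℂ := Metric.closedBall 0 1

instance : CompactSpace closedDisc := isCompact_iff_compactSpace.mp (isCompact_closedBall 0 1)

/-- The disc algebra `A(𝔻)`: continuous functions on the closed unit disc which are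
holomorphic on the open unit disc, viewed as a closed subalgebra of `C(Δ, ℂ)` with the
supremum norm. -/
def discAlgebra : Subalgebra ℂ C(closedDisc, ℂ) where
  carrier := {f | ∃ F : ℂ → ℂ, DifferentiableOn ℂ F (Metric.ball 0 1) ∧ ∀ z : closedDisc, f z = F z}
  mul_mem' := by
    rintro f g ⟨F, hF, hf⟩ ⟨G, hG, hg⟩
    exact ⟨F * G, hF.mul hG, fun z => by simp [hf z, hg z]⟩
  one_mem' := ⟨fun _ => 1, differentiableOn_const 1, fun z => rfl⟩
  add_mem' := by
    rintro f g ⟨F, hF, hf⟩ ⟨G, hG, hg⟩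
    exact ⟨F + G, hF.add hG, fun z => by simp [hf z, hg z]⟩
  zero_mem' := ⟨fun _ => 0, differentiableOn_const 0, fun z => rfl⟩
  algebraMap_mem' := fun c => ⟨fun _ => c, differentiableOn_const c, fun z => rfl⟩

instance : NormedRing ↥discAlgebra := inferInstance
instance : NormedAlgebra ℂ ↥discAlgebra := inferInstance
instance : NormedSpace ℂ ↥discAlgebra := (inferInstance : NormedAlgebra ℂ ↥discAlgebra).toNormedSpace

/-- The dual space `A(𝔻)*` of the disc algebra. -/
abbrev DADual := ↥discAlgebra →L[ℂ] ℂ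

/-- `D : A(𝔻) → A(𝔻)*` is a derivation into the dual bimodule `A(𝔻)*`, where the
bimodule actions are `(f·φ)(u) = φ(fu) = (φ·f)(u)`: the derivation identity
`D(fg) = f·D(g) + g·D(f)` reads `D(fg)(u) = D(g)(fu) + D(f)(gu)`. -/
def IsDerivation (D : ↥discAlgebra →L[ℂ] DADual) : Prop :=
  ∀ f g u : ↥discAlgebra, D (f * g) u = D g (f * u) + D f (g * u)

/-- The standard primitive `K`-th root of unity. -/
def unitRoot (K : ℕ) : ℂ := Complex.exp (2 * π * I / K)

/-- The average of a function over the `K`-th roots of unity. -/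
def rootMean {E : Type*} [AddCommGroup E] [Module ℝ E] (K : ℕ) (F : ℂ → E) : E :=
  (K : ℝ)⁻¹ • ∑ k ∈ Finset.range K, F (unitRoot K ^ k)

lemma norm_unitRoot_pow (K k : ℕ) : ‖unitRoot K ^ k‖ = 1 := by
  have : (2 * π * I / K : ℂ) = ((2 * π / K : ℝ) : ℂ) * I := by push_cast; ring
  rw [norm_pow, unitRoot, this, Complex.norm_exp_ofReal_mul_I, one_pow]

lemma rootMean_mono {K : ℕ} {F G : ℂ → ℝ} (h : ∀ z : ℂ, ‖z‖ = 1 → F z ≤ G z) :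
    rootMean K F ≤ rootMean K G := by
  unfold rootMean
  gcongr with k _
  exact h _ (norm_unitRoot_pow K k)

lemma norm_rootMean_le {K : ℕ} (F : ℂ → ℂ) : ‖rootMean K F‖ ≤ rootMean K fun z => ‖F z‖ := by
  unfold rootMean
  rw [norm_smul, smul_eq_mul, norm_inv, Real.norm_natCast]
  gcongr
  exact norm_sum_le _ _

lemma rootMean_add {E : Type*} [AddCommGroup E] [Module ℝ E] {K : ℕ} (F G : ℂ → E) :
    rootMean K (fun z => F z + G z) = rootMean K F + rootMean K G := by
  simp [rootMean, Finset.sum_add_distrib]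

lemma rootMean_const_mul {K : ℕ} (c : ℝ) (F : ℂ → ℝ) :
    rootMean K (fun z => c * F z) = c * rootMean K F := by
  simp only [rootMean, ← Finset.mul_sum, smul_eq_mul]
  ring

lemma rootMean_const {K : ℕ} (hK : K ≠ 0) (c : ℝ) : rootMean K (fun _ => c) = c := by
  have : (K : ℝ) ≠ 0 := by exact_mod_cast hK
  simp [rootMean, this]

lemma sum_unitRoot_pow_mul_conj {K n m : ℕ} (hn : n < K) (hm : m < K) :
    ∑ k ∈ Finset.range K, (unitRoot K ^ k) ^ n * (starRingEnd ℂ) ((unitRoot K ^ k) ^ m) =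
      if n = m then (K : ℂ) else 0 := by
  have hK : K ≠ 0 := by omega
  have hω : IsPrimitiveRoot (unitRoot K) K := Complex.isPrimitiveRoot_exp K hK
  have h1 : unitRoot K * (starRingEnd ℂ) (unitRoot K) = 1 := by
    have := norm_unitRoot_pow K 1
    rw [pow_one] at this
    rw [Complex.mul_conj, Complex.normSq_eq_norm_sq, this]; simp
  split_ifs with h
  · subst h
    have : ∀ k ∈ Finset.range K,
        (unitRoot K ^ k) ^ n * (starRingEnd ℂ) ((unitRoot K ^ k) ^ n) = 1 := by
      intro k _
      rw [map_pow, map_pow, ← mul_pow, ← mul_pow, h1, one_pow, one_pow]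
    rw [Finset.sum_congr rfl this]; simp
  · set ζ : ℂ := unitRoot K ^ n * (starRingEnd ℂ) (unitRoot K) ^ m with hζ
    have h2 : ∀ k ∈ Finset.range K,
        (unitRoot K ^ k) ^ n * (starRingEnd ℂ) ((unitRoot K ^ k) ^ m) = ζ ^ k := by
      intro k _
      rw [map_pow, map_pow, hζ, mul_pow]; ring
    rw [Finset.sum_congr rfl h2]
    have h3 : ζ ≠ 1 := by
      intro h4
      apply h
      apply hω.pow_inj hn hm
      calc unitRoot K ^ n = unitRoot K ^ n * (unitRoot K * (starRingEnd ℂ) (unitRoot K)) ^ m := by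
            rw [h1]; simp
        _ = ζ * unitRoot K ^ m := by rw [hζ]; ring
        _ = _ := by rw [h4, one_mul]
    have h5 : ζ ^ K = 1 := by
      rw [hζ, mul_pow, ← pow_mul, ← pow_mul, mul_comm n, mul_comm m, pow_mul, pow_mul, ← map_pow,
        hω.pow_eq_one]
      simp
    have := mul_geom_sum ζ K
    rw [h5, sub_self] at this
    exact (mul_eq_zero.mp this).resolve_left (sub_ne_zero.mpr h3)

open Polynomial

lemma rootMean_eval_mul_conj {K : ℕ} {p q : ℂ[X]} (hp : p.natDegree < K) (hq : q.natDegree < K) :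
    rootMean K (fun z => p.eval z * (starRingEnd ℂ) (q.eval z)) =
      ∑ n ∈ Finset.range K, p.coeff n * (starRingEnd ℂ) (q.coeff n) := by
  have hK : (K : ℂ) ≠ 0 := by exact_mod_cast (by omega : K ≠ 0)
  have : ∑ k ∈ Finset.range K, p.eval (unitRoot K ^ k) * (starRingEnd ℂ) (q.eval (unitRoot K ^ k))
      = K * ∑ n ∈ Finset.range K, p.coeff n * (starRingEnd ℂ) (q.coeff n) := by
    calc _ = ∑ k ∈ Finset.range K, ∑ n ∈ Finset.range K, ∑ m ∈ Finset.range K,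
          p.coeff n * (starRingEnd ℂ) (q.coeff m) *
            ((unitRoot K ^ k) ^ n * (starRingEnd ℂ) ((unitRoot K ^ k) ^ m)) := by
          refine Finset.sum_congr rfl fun k _ => ?_
          rw [eval_eq_sum_range' hp, eval_eq_sum_range' hq, map_sum, Finset.sum_mul_sum]
          refine Finset.sum_congr rfl fun n _ => Finset.sum_congr rfl fun m _ => ?_
          rw [map_mul]; ring
      _ = ∑ n ∈ Finset.range K, ∑ m ∈ Finset.range K, p.coeff n * (starRingEnd ℂ) (q.coeff m) *
            (if n = m then (K : ℂ) else 0) := by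
          rw [Finset.sum_comm]
          refine Finset.sum_congr rfl fun n hn => ?_
          rw [Finset.sum_comm]
          refine Finset.sum_congr rfl fun m hm => ?_
          rw [← Finset.mul_sum,
            sum_unitRoot_pow_mul_conj (Finset.mem_range.mp hn) (Finset.mem_range.mp hm)]
      _ = _ := by
          rw [Finset.mul_sum]
          refine Finset.sum_congr rfl fun n hn => ?_
          simp only [mul_ite, mul_zero, Finset.sum_ite_eq, hn, if_true]
          ring
  rw [rootMean, this, Complex.real_smul]
  push_cast
  rw [inv_mul_cancel_left₀ hK]

/-- The square of the `ℓ²` norm of the coefficients of a polynomial. -/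
def coeffSq (p : ℂ[X]) : ℝ := ∑ n ∈ p.support, ‖p.coeff n‖ ^ 2

lemma coeffSq_eq_sum_range {K : ℕ} {p : ℂ[X]} (hp : p.natDegree < K) :
    coeffSq p = ∑ n ∈ Finset.range K, ‖p.coeff n‖ ^ 2 := by
  refine Finset.sum_subset (fun n hn => ?_) fun n _ hn => ?_
  · exact Finset.mem_range.mpr ((le_natDegree_of_mem_supp n hn).trans_lt hp)
  · simp [notMem_support_iff.mp hn]

lemma rootMean_eval_mul_conj_comp {K : ℕ} {p q : ℂ[X]} (hp : p.natDegree < K)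
    (hq : q.natDegree < K) (r : ℝ) :
    rootMean K (fun z => p.eval (r * z) * (starRingEnd ℂ) (q.eval (r * z))) =
      ∑ n ∈ Finset.range K, p.coeff n * (starRingEnd ℂ) (q.coeff n) * (r ^ (2 * n) : ℝ) := by
  have key : ∀ s : ℂ[X], s.natDegree < K → (s.comp (C (r : ℂ) * X)).natDegree < K := by
    intro s hs
    refine lt_of_le_of_lt (natDegree_comp_le.trans ?_) hs
    have : (C (r : ℂ) * X).natDegree ≤ 1 := natDegree_mul_le.trans (by simp)
    simpa using Nat.mul_le_mul_left s.natDegree this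
  have := rootMean_eval_mul_conj (key p hp) (key q hq)
  simp only [eval_comp, eval_mul, eval_C, eval_X, comp_C_mul_X_coeff] at this
  rw [this]
  refine Finset.sum_congr rfl fun n _ => ?_
  rw [map_mul, map_pow, Complex.conj_ofReal]
  push_cast
  ring

lemma rootMean_norm_sq_comp {K : ℕ} {p : ℂ[X]} (hp : p.natDegree < K) (r : ℝ) :
    rootMean K (fun z => ‖p.eval (r * z)‖ ^ 2) =
      ∑ n ∈ Finset.range K, ‖p.coeff n‖ ^ 2 * r ^ (2 * n) := by
  have := rootMean_eval_mul_conj_comp hp hp r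
  simp only [Complex.mul_conj, Complex.normSq_eq_norm_sq] at this
  apply Complex.ofReal_injective
  simp only [rootMean, Complex.real_smul, smul_eq_mul] at this ⊢
  push_cast at this ⊢
  exact this

lemma rootMean_norm_sq {K : ℕ} {p : ℂ[X]} (hp : p.natDegree < K) :
    rootMean K (fun z => ‖p.eval z‖ ^ 2) = coeffSq p := by
  simpa [coeffSq_eq_sum_range hp] using rootMean_norm_sq_comp hp 1

lemma integral_negMulLog_mul_pow (n : ℕ) :
    ∫ r in (0 : ℝ)..1, negMulLog r * r ^ (2 * n) = 1 / (4 * (n + 1) ^ 2) := by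
  have hn : (n : ℝ) + 1 ≠ 0 := by positivity
  have h := intervalIntegral.integral_eq_sub_of_hasDerivAt_of_le (a := 0) (b := 1) zero_le_one
    (f := fun r => r ^ (2 * n + 1) * negMulLog r / (2 * (n + 1)) +
      r ^ (2 * n + 2) / (4 * (n + 1) ^ 2))
    (f' := fun r => negMulLog r * r ^ (2 * n)) (by fun_prop) ?_ ?_
  · rw [h]; simp
  · intro r hr
    have hr0 : r ≠ 0 := hr.1.ne'
    have h1 := (((hasDerivAt_pow (2 * n + 1) r).mul (hasDerivAt_negMulLog hr0)).div_const
      (2 * ((n : ℝ) + 1))).add ((hasDerivAt_pow (2 * n + 2) r).div_const (4 * ((n : ℝ) + 1) ^ 2))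
    refine h1.congr_deriv ?_
    simp only [negMulLog, Nat.add_sub_cancel, show 2 * n + 2 - 1 = 2 * n + 1 by omega]
    push_cast
    field_simp
    ring
  · exact (by fun_prop : Continuous fun r => negMulLog r * r ^ (2 * n)).intervalIntegrable _ _

lemma integral_negMulLog_rootMean_norm_sq {K : ℕ} {p : ℂ[X]} (hp : p.natDegree < K) :
    ∫ r in (0 : ℝ)..1, negMulLog r * rootMean K (fun z => ‖p.eval (r * z)‖ ^ 2) =
      ∑ n ∈ Finset.range K, ‖p.coeff n‖ ^ 2 / (4 * (n + 1) ^ 2) := by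
  simp only [rootMean_norm_sq_comp hp, Finset.mul_sum]
  rw [intervalIntegral.integral_finsetSum fun n _ => Continuous.intervalIntegrable (by fun_prop) _ _]
  refine Finset.sum_congr rfl fun n _ => ?_
  have : ∀ r : ℝ, negMulLog r * (‖p.coeff n‖ ^ 2 * r ^ (2 * n)) =
      ‖p.coeff n‖ ^ 2 * (negMulLog r * r ^ (2 * n)) := fun r => by ring
  simp only [this]
  rw [intervalIntegral.integral_const_mul, integral_negMulLog_mul_pow]
  ring

lemma integral_negMulLog_rootMean_mul_conj {K : ℕ} {p q : ℂ[X]} (hp : p.natDegree < K)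
    (hq : q.natDegree < K) :
    ∫ r in (0 : ℝ)..1, (negMulLog r : ℂ) *
        rootMean K (fun z => p.eval (r * z) * (starRingEnd ℂ) (q.eval (r * z))) =
      ∑ n ∈ Finset.range K, p.coeff n * (starRingEnd ℂ) (q.coeff n) / (4 * (n + 1) ^ 2) := by
  simp only [rootMean_eval_mul_conj_comp hp hq, Finset.mul_sum]
  rw [intervalIntegral.integral_finsetSum fun n _ => Continuous.intervalIntegrable (by fun_prop) _ _]
  refine Finset.sum_congr rfl fun n _ => ?_
  have : ∀ r : ℝ, (negMulLog r : ℂ) *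
      (p.coeff n * (starRingEnd ℂ) (q.coeff n) * (r ^ (2 * n) : ℝ)) =
      p.coeff n * (starRingEnd ℂ) (q.coeff n) * ((negMulLog r * r ^ (2 * n) : ℝ) : ℂ) :=
    fun r => by push_cast; ring
  simp only [this]
  rw [intervalIntegral.integral_const_mul, intervalIntegral.integral_ofReal,
    integral_negMulLog_mul_pow]
  push_cast
  ring

/-- The Littlewood–Paley inequality for polynomials. -/
lemma integral_negMulLog_derivative_le {K : ℕ} {p : ℂ[X]} (hp : p.natDegree < K) :
    4 * ∫ r in (0 : ℝ)..1, negMulLog r *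
      rootMean K (fun z => ‖(derivative p).eval (r * z)‖ ^ 2) ≤ coeffSq p := by
  have hp' : (derivative p).natDegree < K := (natDegree_derivative_le p).trans_lt (by omega)
  rw [integral_negMulLog_rootMean_norm_sq hp',
    coeffSq_eq_sum_range (show p.natDegree < K + 1 by omega), Finset.sum_range_succ', Finset.mul_sum]
  refine le_add_of_le_of_nonneg (Finset.sum_le_sum fun n _ => le_of_eq ?_) (by positivity)
  have hn : (n : ℝ) + 1 ≠ 0 := by positivity
  have : ‖(n : ℂ) + 1‖ = n + 1 := by
    rw [← Nat.cast_succ, Complex.norm_natCast]; push_cast; rfl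
  rw [coeff_derivative, norm_mul, this]
  field_simp

lemma continuous_negMulLog_mul_rootMean (K : ℕ) (p : ℂ[X]) : Continuous fun r : ℝ =>
    negMulLog r * rootMean K (fun z => ‖p.eval (r * z)‖ ^ 2) := by
  have : ∀ z : ℂ, Continuous fun r : ℝ => p.eval (r * z) := fun z =>
    p.continuous.comp (by fun_prop)
  unfold rootMean
  fun_prop

lemma norm_derivative_mul_mul_le {f g a c : ℂ[X]} {z : ℂ} (hf : ‖f.eval z‖ ≤ 1)
    (hg : ‖g.eval z‖ ≤ 1) :
    ‖(derivative f * g).eval z * (starRingEnd ℂ) ((derivative (a * c)).eval z)‖ ≤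
      ‖(derivative (f * a)).eval z‖ ^ 2 + ‖(derivative (f * c)).eval z‖ ^ 2 +
        3 / 2 * (‖(derivative a).eval z‖ ^ 2 + ‖(derivative c).eval z‖ ^ 2) := by
  simp only [derivative_mul, eval_add, eval_mul, norm_mul, RCLike.norm_conj]
  set f' := (derivative f).eval z
  set a' := (derivative a).eval z
  set c' := (derivative c).eval z
  set f₀ := f.eval z
  set a₀ := a.eval z
  set c₀ := c.eval z
  have key : ∀ b b' : ℂ, ‖f'‖ * ‖b‖ ≤ ‖f' * b + f₀ * b'‖ + ‖b'‖ := by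
    intro b b'
    calc ‖f'‖ * ‖b‖ = ‖(f' * b + f₀ * b') - f₀ * b'‖ := by rw [← norm_mul]; congr 1; ring
      _ ≤ ‖f' * b + f₀ * b'‖ + ‖f₀‖ * ‖b'‖ := by rw [← norm_mul]; exact norm_sub_le _ _
      _ ≤ _ := by gcongr; exact mul_le_of_le_one_left (norm_nonneg _) hf
  have h1 := key a₀ a'
  have h2 := key c₀ c'
  set A := ‖f' * a₀ + f₀ * a'‖
  set B := ‖f' * c₀ + f₀ * c'‖
  calc ‖f'‖ * ‖g.eval z‖ * ‖a' * c₀ + a₀ * c'‖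
      ≤ ‖f'‖ * 1 * (‖a'‖ * ‖c₀‖ + ‖a₀‖ * ‖c'‖) := by
        gcongr
        rw [← norm_mul, ← norm_mul]; exact norm_add_le _ _
    _ = ‖a'‖ * (‖f'‖ * ‖c₀‖) + (‖f'‖ * ‖a₀‖) * ‖c'‖ := by ring
    _ ≤ ‖a'‖ * (B + ‖c'‖) + (A + ‖a'‖) * ‖c'‖ := by gcongr
    _ ≤ _ := by nlinarith [sq_nonneg (‖a'‖ - B), sq_nonneg (A - ‖c'‖), sq_nonneg (‖a'‖ - ‖c'‖),
        sq_nonneg A, sq_nonneg B]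

lemma coeffSq_mul_le {f a : ℂ[X]} (hf : ∀ z : ℂ, ‖z‖ ≤ 1 → ‖f.eval z‖ ≤ 1) :
    coeffSq (f * a) ≤ coeffSq a := by
  set K := (f * a).natDegree + a.natDegree + 1
  rw [← rootMean_norm_sq (show (f * a).natDegree < K by omega),
    ← rootMean_norm_sq (show a.natDegree < K by omega)]
  refine rootMean_mono fun z hz => ?_
  rw [eval_mul, norm_mul]
  gcongr
  exact mul_le_of_le_one_left (norm_nonneg _) (hf z hz.le)

/-- The Hankel-type form attached to the product of two `H²` functions is bounded in the
supremum norm. -/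
lemma norm_sum_coeff_derivative_mul_le {f g a c : ℂ[X]} (hf : ∀ z : ℂ, ‖z‖ ≤ 1 → ‖f.eval z‖ ≤ 1)
    (hg : ∀ z : ℂ, ‖z‖ ≤ 1 → ‖g.eval z‖ ≤ 1) {L : ℕ} (hL : (derivative f * g).natDegree < L) :
    ‖∑ l ∈ Finset.range L, (derivative f * g).coeff l *
      (starRingEnd ℂ) ((a * c).coeff (l + 1)) / (l + 1)‖ ≤ 5 / 2 * (coeffSq a + coeffSq c) := by
  set p := derivative f * g with hp
  set q := derivative (a * c) with hq
  set K := L + q.natDegree + (f * a).natDegree + (f * c).natDegree + a.natDegree + c.natDegree + 1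
    with hK
  have hsum : ∑ l ∈ Finset.range L, p.coeff l * (starRingEnd ℂ) ((a * c).coeff (l + 1)) / (l + 1) =
      4 * ∫ r in (0 : ℝ)..1, (negMulLog r : ℂ) *
        rootMean K (fun z => p.eval (r * z) * (starRingEnd ℂ) (q.eval (r * z))) := by
    rw [integral_negMulLog_rootMean_mul_conj (by omega) (by omega), Finset.mul_sum]
    have hsub : Finset.range L ⊆ Finset.range K := Finset.range_mono (by omega)
    rw [Finset.sum_subset hsub]
    · refine Finset.sum_congr rfl fun l _ => ?_
      have hl : (l : ℂ) + 1 ≠ 0 := by exact_mod_cast Nat.succ_ne_zero l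
      rw [hq, coeff_derivative, map_mul, map_add, map_one, Complex.conj_natCast]
      field_simp
    · intro l _ hl
      rw [coeff_eq_zero_of_natDegree_lt (lt_of_lt_of_le hL (by simpa using hl))]
      simp
  have hcont := continuous_negMulLog_mul_rootMean K
  have hmono : ‖∫ r in (0 : ℝ)..1, (negMulLog r : ℂ) *
        rootMean K (fun z => p.eval (r * z) * (starRingEnd ℂ) (q.eval (r * z)))‖ ≤
      ∫ r in (0 : ℝ)..1,
        (negMulLog r * rootMean K (fun z => ‖(derivative (f * a)).eval (r * z)‖ ^ 2) +
         negMulLog r * rootMean K (fun z => ‖(derivative (f * c)).eval (r * z)‖ ^ 2) +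
         3 / 2 * (negMulLog r * rootMean K (fun z => ‖(derivative a).eval (r * z)‖ ^ 2) +
          negMulLog r * rootMean K (fun z => ‖(derivative c).eval (r * z)‖ ^ 2))) := by
    refine intervalIntegral.norm_integral_le_of_norm_le zero_le_one ?_ ?_
    · refine Filter.Eventually.of_forall fun r hr => ?_
      have hw : 0 ≤ negMulLog r := negMulLog_nonneg hr.1.le hr.2
      rw [norm_mul, Complex.norm_real, Real.norm_of_nonneg hw]
      refine (mul_le_mul_of_nonneg_left (norm_rootMean_le _) hw).trans ?_
      simp only [← rootMean_const_mul, ← rootMean_add]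
      refine rootMean_mono fun z hz => ?_
      rw [← mul_add, ← mul_add, mul_left_comm, ← mul_add]
      refine mul_le_mul_of_nonneg_left ?_ hw
      have hrz : ‖(r : ℂ) * z‖ ≤ 1 := by
        rw [norm_mul, hz, mul_one, Complex.norm_real, Real.norm_of_nonneg hr.1.le]; exact hr.2
      exact norm_derivative_mul_mul_le (hf _ hrz) (hg _ hrz)
    · exact (((hcont _).add (hcont _)).add
        (continuous_const.mul ((hcont _).add (hcont _)))).intervalIntegrable _ _
  have hii : ∀ s : ℂ[X], IntervalIntegrable
      (fun r : ℝ => negMulLog r * rootMean K (fun z => ‖s.eval (r * z)‖ ^ 2)) volume 0 1 :=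
    fun s => (hcont s).intervalIntegrable _ _
  rw [intervalIntegral.integral_add ((hii _).add (hii _)) (((hii _).add (hii _)).const_mul _),
    intervalIntegral.integral_add (hii _) (hii _), intervalIntegral.integral_const_mul,
    intervalIntegral.integral_add (hii _) (hii _)] at hmono
  have h1 := integral_negMulLog_derivative_le (show (f * a).natDegree < K by omega)
  have h2 := integral_negMulLog_derivative_le (show (f * c).natDegree < K by omega)
  have h3 := integral_negMulLog_derivative_le (show a.natDegree < K by omega)
  have h4 := integral_negMulLog_derivative_le (show c.natDegree < K by omega)
  have h5 := coeffSq_mul_le (a := a) hf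
  have h6 := coeffSq_mul_le (a := c) hf
  rw [hsum, norm_mul, Complex.norm_ofNat]
  linarith

/-- Real parts of polynomials are uniformly dense among real functions on the circle. -/
lemma exists_polynomial_re_approx (u : C(Metric.sphere (0 : ℂ) 1, ℝ)) {ε : ℝ} (hε : 0 < ε) :
    ∃ w : ℂ[X], ∀ z : Metric.sphere (0 : ℂ) 1, |(w.eval (z : ℂ)).re - u z| ≤ ε := by
  have : Fact (0 < 2 * π) := ⟨Real.two_pi_pos⟩
  let e : C(AddCircle (2 * π), Metric.sphere (0 : ℂ) 1) :=
    ⟨fun t => ⟨(AddCircle.toCircle t : ℂ), by simp [Circle.norm_coe]⟩, by fun_prop⟩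
  let v : C(AddCircle (2 * π), ℂ) := ⟨fun t => (u (e t) : ℂ), by fun_prop⟩
  have hv : v ∈ (Submodule.span ℂ (Set.range (@fourier (2 * π)))).topologicalClosure := by
    rw [span_fourier_closure_eq_top]; trivial
  rw [← SetLike.mem_coe, Submodule.topologicalClosure_coe, Metric.mem_closure_iff] at hv
  obtain ⟨q, hq, hvq⟩ := hv ε hε
  have hspan : ∀ c : ℂ, ∃ w : ℂ[X], ∀ t, (w.eval (AddCircle.toCircle t : ℂ)).re = (c * q t).re := by
    refine Submodule.span_induction (p := fun q _ => ∀ c : ℂ, ∃ w : ℂ[X],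
      ∀ t, (w.eval (AddCircle.toCircle t : ℂ)).re = (c * q t).re) ?_ ?_ ?_ ?_ hq
    · rintro _ ⟨n, rfl⟩ c
      obtain ⟨m, rfl | rfl⟩ := n.eq_nat_or_neg
      · exact ⟨C c * X ^ m, fun t => by simp [fourier_apply, AddCircle.toCircle_nsmul]⟩
      · refine ⟨C ((starRingEnd ℂ) c) * X ^ m, fun t => ?_⟩
        simp only [fourier_apply, neg_smul, natCast_zsmul, AddCircle.toCircle_neg,
          AddCircle.toCircle_nsmul, Circle.coe_inv_eq_conj, Circle.coe_pow, eval_mul, eval_C,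
          eval_pow, eval_X]
        rw [← Complex.conj_re, map_mul, map_pow, Complex.conj_conj]
    · exact fun c => ⟨0, fun t => by simp⟩
    · intro x y _ _ hx hy c
      obtain ⟨w₁, h₁⟩ := hx c
      obtain ⟨w₂, h₂⟩ := hy c
      exact ⟨w₁ + w₂, fun t => by
        rw [eval_add, Complex.add_re, h₁, h₂, ContinuousMap.add_apply, mul_add, Complex.add_re]⟩
    · intro a x _ hx c
      obtain ⟨w, hw⟩ := hx (c * a)
      exact ⟨w, fun t => by rw [hw, ContinuousMap.smul_apply, smul_eq_mul, mul_assoc]⟩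
  obtain ⟨w, hw⟩ := hspan 1
  refine ⟨w, fun z => ?_⟩
  obtain ⟨t, ht⟩ : ∃ t, e t = z := by
    obtain ⟨t, ht⟩ := (AddCircle.homeomorphCircle (T := 2 * π) (by positivity)).surjective
      ⟨z, by simp [Submonoid.unitSphere]⟩
    refine ⟨t, Subtype.ext ?_⟩
    simpa [e, AddCircle.homeomorphCircle_apply] using congrArg (fun c : Circle => (c : ℂ)) ht
  have h1 : ‖v t - q t‖ ≤ ε := by
    rw [← dist_eq_norm]
    exact (ContinuousMap.dist_apply_le_dist t).trans hvq.le
  have h2 : (z : ℂ) = AddCircle.toCircle t := by rw [← ht]; rfl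
  rw [h2, hw t, one_mul, abs_sub_comm]
  have h3 : (v t - q t).re = u z - (q t).re := by simp [v, ht]
  rw [← h3]
  exact (Complex.abs_re_le_norm _).trans h1

/-- The coordinate function as an element of the disc algebra. -/
def discCoord : discAlgebra :=
  ⟨⟨fun z => (z : ℂ), continuous_subtype_val⟩, ⟨id, differentiableOn_id, fun _ => rfl⟩⟩

/-- Polynomials as elements of the disc algebra. -/
def polyToDisc : ℂ[X] →ₐ[ℂ] discAlgebra := aeval discCoord

lemma polyToDisc_apply (p : ℂ[X]) (z : closedDisc) :
    (polyToDisc p : C(closedDisc, ℂ)) z = p.eval (z : ℂ) := by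
  induction p using Polynomial.induction_on' with
  | add p q hp hq => rw [map_add, eval_add, ← hp, ← hq]; rfl
  | monomial n a =>
    rw [polyToDisc, aeval_monomial, eval_monomial]
    change a * ((discCoord : C(closedDisc, ℂ)) ^ n) z = _
    rw [ContinuousMap.pow_apply]
    rfl

lemma norm_eval_le_norm_polyToDisc (p : ℂ[X]) {z : ℂ} (hz : ‖z‖ ≤ 1) :
    ‖p.eval z‖ ≤ ‖polyToDisc p‖ := by
  rw [← polyToDisc_apply p ⟨z, by simpa using hz⟩]
  exact ContinuousMap.norm_coe_le_norm (polyToDisc p : C(closedDisc, ℂ)) _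

lemma norm_discCoord_pow_le (n : ℕ) : ‖discCoord ^ n‖ ≤ 1 := by
  change ‖((discCoord ^ n : discAlgebra) : C(closedDisc, ℂ))‖ ≤ 1
  rw [ContinuousMap.norm_le _ zero_le_one]
  intro z
  change ‖((discCoord : C(closedDisc, ℂ)) ^ n) z‖ ≤ 1
  rw [ContinuousMap.pow_apply, norm_pow]
  exact pow_le_one₀ (norm_nonneg _) (mem_closedBall_zero_iff.mp z.2)

/-- Polynomials are dense in the disc algebra. -/
lemma exists_polynomial_norm_sub_le (f : discAlgebra) {ε : ℝ} (hε : 0 < ε) :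
    ∃ p : ℂ[X], ‖polyToDisc p - f‖ ≤ ε := by
  obtain ⟨f, F, hF, hfF⟩ := f
  have huc : UniformContinuous f := CompactSpace.uniformContinuous_of_continuous f.continuous
  obtain ⟨δ, hδ, hδf⟩ := Metric.uniformContinuous_iff.mp huc (ε / 2) (by positivity)
  obtain ⟨r, hr0, hr1, hrδ⟩ : ∃ r : ℝ, 0 < r ∧ r < 1 ∧ 1 - r < δ :=
    ⟨max (1 / 2) (1 - δ / 2), by positivity, max_lt (by norm_num) (by linarith), by
      have := le_max_right (1 / 2) (1 - δ / 2); linarith⟩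
  obtain ⟨s, hrs, hs1⟩ := exists_between hr1
  obtain ⟨t, hst, ht1⟩ := exists_between hs1
  have hs0 : 0 < s := hr0.trans hrs
  lift t to NNReal using (hs0.trans hst).le
  lift s to NNReal using hs0.le
  have hps := (hF.mono (closedBall_subset_ball ht1)).hasFPowerSeriesOnBall (c := 0) (R := t)
    (by exact_mod_cast (show (0 : ℝ) < t from hs0.trans hst))
  set P := cauchyPowerSeries F 0 t
  have hunif := hps.tendstoUniformlyOn (r' := s) (by exact_mod_cast hst)
  rw [Metric.tendstoUniformlyOn_iff] at hunif
  obtain ⟨n, hn⟩ := (hunif (ε / 2) (by positivity)).exists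
  refine ⟨∑ k ∈ Finset.range n, C (P.coeff k * (r : ℂ) ^ k) * X ^ k, ?_⟩
  change ‖((polyToDisc _ : discAlgebra) : C(closedDisc, ℂ)) - f‖ ≤ ε
  rw [ContinuousMap.norm_le _ hε.le]
  intro z
  have hz : ‖(z : ℂ)‖ ≤ 1 := mem_closedBall_zero_iff.mp z.2
  have hrz : ‖(r : ℂ) * z‖ ≤ r := by
    rw [norm_mul, Complex.norm_real, Real.norm_of_nonneg hr0.le]
    exact mul_le_of_le_one_right hr0.le hz
  have h1 := hn (r * z) (by rw [mem_ball_zero_iff]; exact hrz.trans_lt hrs)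
  have h2 : dist (f z) (f ⟨r * z, by simpa using hrz.trans hr1.le⟩) < ε / 2 := by
    apply hδf
    rw [Subtype.dist_eq, dist_eq_norm]
    have : (z : ℂ) - r * z = ((1 - r : ℝ) : ℂ) * z := by push_cast; ring
    change ‖(z : ℂ) - r * z‖ < δ
    rw [this, norm_mul, Complex.norm_real, Real.norm_of_nonneg (by linarith)]
    exact (mul_le_of_le_one_right (by linarith) hz).trans_lt hrδ
  rw [hfF ⟨r * z, _⟩] at h2
  have h3 : P.partialSum n (r * z) =
      eval (z : ℂ) (∑ k ∈ Finset.range n, C (P.coeff k * (r : ℂ) ^ k) * X ^ k) := by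
    simp only [FormalMultilinearSeries.partialSum, eval_finsetSum,
      FormalMultilinearSeries.apply_eq_pow_smul_coeff, smul_eq_mul]
    refine Finset.sum_congr rfl fun k _ => ?_
    simp only [eval_mul, eval_C, eval_pow, eval_X]
    ring
  rw [zero_add, h3] at h1
  rw [ContinuousMap.sub_apply, polyToDisc_apply, ← dist_eq_norm, dist_comm]
  linarith [dist_triangle (f z) (F (r * z))
    (eval (z : ℂ) (∑ k ∈ Finset.range n, C (P.coeff k * (r : ℂ) ^ k) * X ^ k))]

/-- Exponentials of elements of the disc algebra. -/
lemma exp_mem_discAlgebra (f : discAlgebra) :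
    ∃ e : discAlgebra, (∀ z, (e : C(closedDisc, ℂ)) z = Complex.exp ((f : C(closedDisc, ℂ)) z)) ∧
      HasSum (fun n : ℕ => (n.factorial : ℂ)⁻¹ • f ^ n) e := by
  have hexp : ∀ z, NormedSpace.exp (f : C(closedDisc, ℂ)) z =
      Complex.exp ((f : C(closedDisc, ℂ)) z) := by
    intro z
    have := NormedSpace.map_exp (ContinuousMap.evalAlgHom ℂ ℂ z) (continuous_eval_const z)
      (f : C(closedDisc, ℂ))
    rw [Complex.exp_eq_exp_ℂ]
    exact this
  have hmem : NormedSpace.exp (f : C(closedDisc, ℂ)) ∈ discAlgebra := by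
    obtain ⟨F, hF, hf⟩ := f.2
    exact ⟨fun z => Complex.exp (F z), hF.cexp, fun z => by rw [hexp, hf]⟩
  refine ⟨⟨_, hmem⟩, hexp, ?_⟩
  refine (Topology.IsInducing.hasSum_iff (g := discAlgebra.val) Topology.IsInducing.subtypeVal
    _ _).mp ?_
  exact NormedSpace.exp_series_hasSum_exp' (𝕂 := ℂ) (f : C(closedDisc, ℂ))

lemma exists_polynomial_exp_approx (w : ℂ[X]) {ε : ℝ} (hε : 0 < ε) :
    ∃ p : ℂ[X], ∀ z : ℂ, ‖z‖ ≤ 1 → ‖p.eval z - Complex.exp (w.eval z)‖ ≤ ε := by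
  obtain ⟨e, he, -⟩ := exp_mem_discAlgebra (polyToDisc w)
  obtain ⟨p, hp⟩ := exists_polynomial_norm_sub_le e hε
  refine ⟨p, fun z hz => ?_⟩
  have hz' : z ∈ closedDisc := by simpa using hz
  have h1 := ContinuousMap.norm_coe_le_norm
    ((polyToDisc p - e : discAlgebra) : C(closedDisc, ℂ)) ⟨z, hz'⟩
  change ‖(polyToDisc p : C(closedDisc, ℂ)) ⟨z, hz'⟩ - (e : C(closedDisc, ℂ)) ⟨z, hz'⟩‖ ≤ _ at h1
  rw [he, polyToDisc_apply, polyToDisc_apply] at h1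
  exact h1.trans hp

lemma norm_coeff_le {p : ℂ[X]} {s : ℝ} (hp : ∀ z : ℂ, ‖z‖ = 1 → ‖p.eval z‖ ≤ s) (n : ℕ) :
    ‖p.coeff n‖ ≤ s := by
  set K := p.natDegree + n + 1
  have h1 := rootMean_eval_mul_conj (K := K) (p := p) (q := X ^ n) (by omega)
    (by rw [natDegree_X_pow]; omega)
  have h2 : ∑ m ∈ Finset.range K, p.coeff m * (starRingEnd ℂ) ((X ^ n : ℂ[X]).coeff m) =
      p.coeff n := by
    rw [Finset.sum_eq_single n]
    · simp
    · intro m _ hm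
      simp [coeff_X_pow, hm]
    · intro h
      exact absurd (Finset.mem_range.mpr (by omega)) h
  rw [← h2, ← h1]
  refine (norm_rootMean_le _).trans ?_
  rw [← rootMean_const (show K ≠ 0 by omega) s]
  refine rootMean_mono fun z hz => ?_
  rw [norm_mul, RCLike.norm_conj, eval_pow, eval_X, norm_pow, hz, one_pow, mul_one]
  exact hp z hz

lemma denseRange_polyToDisc : DenseRange polyToDisc := by
  intro f
  rw [Metric.mem_closure_iff]
  intro ε hε
  obtain ⟨p, hp⟩ := exists_polynomial_norm_sub_le f (half_pos hε)
  refine ⟨_, ⟨p, rfl⟩, ?_⟩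
  rw [dist_comm, dist_eq_norm]
  linarith

/-- A bounded functional on the disc algebra extending the `n`-th coefficient of a polynomial. -/
lemma exists_coeff_functional (n : ℕ) :
    ∃ ℓ : discAlgebra →L[ℂ] ℂ, ∀ p : ℂ[X], ℓ (polyToDisc p) = p.coeff n := by
  refine ⟨(Polynomial.lcoeff ℂ n).extendOfNorm polyToDisc.toLinearMap, fun p => ?_⟩
  exact LinearMap.extendOfNorm_eq denseRange_polyToDisc
    ⟨1, fun p => by
      rw [one_mul]
      exact norm_coeff_le (fun z hz => norm_eval_le_norm_polyToDisc p hz.le) n⟩ p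

lemma rootMean_eval_mul_re {K : ℕ} {h w : ℂ[X]} (hh : h.natDegree + w.natDegree < K)
    (h0 : h.coeff 0 = 0) :
    rootMean K (fun z => h.eval z * ((w.eval z).re : ℂ)) =
      (∑ n ∈ Finset.range K, h.coeff n * (starRingEnd ℂ) (w.coeff n)) / 2 := by
  have h1 := rootMean_eval_mul_conj (K := K) (p := h) (q := w) (by omega) (by omega)
  have h2 := rootMean_eval_mul_conj (K := K) (p := h * w) (q := 1)
    (natDegree_mul_le.trans_lt hh) (by rw [natDegree_one]; omega)
  have h3 : ∑ n ∈ Finset.range K, (h * w).coeff n * (starRingEnd ℂ) ((1 : ℂ[X]).coeff n) = 0 := by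
    refine Finset.sum_eq_zero fun n _ => ?_
    rcases eq_or_ne n 0 with rfl | hn
    · rw [mul_coeff_zero, h0, zero_mul, zero_mul]
    · simp [coeff_one, hn]
  rw [← h1, eq_div_iff two_ne_zero, 
    ← add_zero (rootMean K fun z => h.eval z * (starRingEnd ℂ) (w.eval z)), ← h3, ← h2]
  simp only [rootMean, Complex.real_smul]
  rw [← mul_add, mul_assoc, ← Finset.sum_add_distrib, Finset.sum_mul]
  congr 1
  refine Finset.sum_congr rfl fun k _ => ?_
  rw [Complex.re_eq_add_conj]
  simp only [eval_mul, eval_one, map_one]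
  ring

lemma norm_coeff_le_of_re_le {w : ℂ[X]} {R : ℝ} (hw : ∀ z : ℂ, ‖z‖ = 1 → |(w.eval z).re| ≤ R)
    {n : ℕ} (hn : n ≠ 0) : ‖w.coeff n‖ ≤ 2 * R := by
  set K := n + w.natDegree + 1
  have h1 := rootMean_eval_mul_re (K := K) (h := X ^ n) (w := w) (by rw [natDegree_X_pow]; omega)
    (by simp [coeff_X_pow, hn.symm])
  have h2 : ∑ m ∈ Finset.range K, (X ^ n : ℂ[X]).coeff m * (starRingEnd ℂ) (w.coeff m) =
      (starRingEnd ℂ) (w.coeff n) := by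
    rw [Finset.sum_eq_single n]
    · simp
    · intro m _ hm
      simp [coeff_X_pow, hm]
    · intro h
      exact absurd (Finset.mem_range.mpr (by omega)) h
  have h3 : ‖rootMean K fun z => (X ^ n : ℂ[X]).eval z * ((w.eval z).re : ℂ)‖ ≤ R := by
    refine (norm_rootMean_le _).trans ?_
    rw [← rootMean_const (show K ≠ 0 by omega) R]
    refine rootMean_mono fun z hz => ?_
    rw [norm_mul, eval_pow, eval_X, norm_pow, hz, one_pow, one_mul, Complex.norm_real]
    exact hw z hz
  rw [h1, h2, norm_div, RCLike.norm_conj, Complex.norm_ofNat] at h3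
  linarith

/-- The maximum principle for the real part of a polynomial. -/
lemma abs_re_eval_le {w : ℂ[X]} {R : ℝ} (hw : ∀ z : ℂ, ‖z‖ = 1 → |(w.eval z).re| ≤ R)
    {z : ℂ} (hz : ‖z‖ ≤ 1) : |(w.eval z).re| ≤ R := by
  have key : ∀ v : ℂ[X], (∀ z : ℂ, ‖z‖ = 1 → (v.eval z).re ≤ R) → (v.eval z).re ≤ R := by
    intro v hv
    have hd : Differentiable ℂ fun z => Complex.exp (v.eval z) := v.differentiable.cexp
    have := Complex.norm_le_of_forall_mem_frontier_norm_le (U := ball (0 : ℂ) 1)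
      (C := Real.exp R) isBounded_ball hd.diffContOnCl (fun ζ hζ => by
        rw [frontier_ball _ one_ne_zero, mem_sphere_zero_iff_norm] at hζ
        rw [Complex.norm_exp]
        exact Real.exp_le_exp.mpr (hv ζ hζ)) (z := z)
      (by rw [closure_ball _ one_ne_zero]; exact mem_closedBall_zero_iff.mpr hz)
    rw [Complex.norm_exp] at this
    exact Real.exp_le_exp.mp this
  rw [abs_le]
  refine ⟨?_, key w fun ζ hζ => (abs_le.mp (hw ζ hζ)).2⟩
  have := key (-w) fun ζ hζ => by
    rw [eval_neg, Complex.neg_re]; linarith [(abs_le.mp (hw ζ hζ)).1]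
  rw [eval_neg, Complex.neg_re] at this
  linarith

lemma IsDerivation.apply_one {D : discAlgebra →L[ℂ] DADual} (hD : IsDerivation D) (u : discAlgebra) :
    D 1 u = 0 := by
  have := hD 1 1 u
  simpa using this

lemma IsDerivation.apply_pow {D : discAlgebra →L[ℂ] DADual} (hD : IsDerivation D)
    (f u : discAlgebra) (n : ℕ) : D (f ^ (n + 1)) u = (n + 1) * D f (f ^ n * u) := by
  induction n generalizing u with
  | zero => simp
  | succ n ih =>
    rw [pow_succ, hD, mul_comm f u, ih]
    have : f ^ n * (u * f) = f ^ (n + 1) * u := by ring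
    rw [this]
    push_cast
    ring

lemma IsDerivation.apply_exp {D : discAlgebra →L[ℂ] DADual} (hD : IsDerivation D)
    {f e : discAlgebra} (he : HasSum (fun n : ℕ => (n.factorial : ℂ)⁻¹ • f ^ n) e)
    (u : discAlgebra) : D e u = D f (e * u) := by
  have h1 : HasSum (fun n : ℕ => (n.factorial : ℂ)⁻¹ • D (f ^ n) u) (D e u) := by
    have := ((ContinuousLinearMap.apply ℂ ℂ u).comp D).hasSum he
    simpa using this
  have h2 : HasSum (fun n : ℕ => (n.factorial : ℂ)⁻¹ • D f (f ^ n * u)) (D f (e * u)) := by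
    have := ((D f).comp ((ContinuousLinearMap.mul ℂ discAlgebra).flip u)).hasSum he
    simpa [mul_comm u] using this
  rw [← hasSum_nat_add_iff' 1] at h1
  refine HasSum.unique (f := fun n : ℕ => (n.factorial : ℂ)⁻¹ • D f (f ^ n * u)) ?_ h2
  have h3 : (fun n : ℕ => (n.factorial : ℂ)⁻¹ • D f (f ^ n * u)) =
      fun n : ℕ => ((n + 1).factorial : ℂ)⁻¹ • D (f ^ (n + 1)) u := by
    funext n
    rw [hD.apply_pow, Nat.factorial_succ]
    have : (n : ℂ) + 1 ≠ 0 := by exact_mod_cast Nat.succ_ne_zero n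
    have : (n.factorial : ℂ) ≠ 0 := by exact_mod_cast n.factorial_ne_zero
    simp only [smul_eq_mul]
    push_cast
    field_simp
  rw [h3]
  simpa [hD.apply_one] using h1

/-- A derivation is bounded on functions with bounded real part. -/
lemma IsDerivation.norm_apply_one_le {D : discAlgebra →L[ℂ] DADual} (hD : IsDerivation D)
    {f : discAlgebra} {R : ℝ} (hf : ∀ z, |((f : C(closedDisc, ℂ)) z).re| ≤ R) :
    ‖D f 1‖ ≤ ‖D‖ * Real.exp R * Real.exp R := by
  obtain ⟨e, he, hes⟩ := exp_mem_discAlgebra f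
  obtain ⟨e', he', -⟩ := exp_mem_discAlgebra (-f)
  have h1 : e * e' = 1 := by
    apply Subtype.ext
    ext z
    change (e : C(closedDisc, ℂ)) z * (e' : C(closedDisc, ℂ)) z = 1
    rw [he, he', ← Complex.exp_add]
    change Complex.exp (_ + -(f : C(closedDisc, ℂ)) z) = 1
    rw [add_neg_cancel, Complex.exp_zero]
  have hn : ‖e‖ ≤ Real.exp R := by
    change ‖(e : C(closedDisc, ℂ))‖ ≤ _
    rw [ContinuousMap.norm_le _ (Real.exp_pos R).le]
    intro z
    rw [he, Complex.norm_exp]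
    exact Real.exp_le_exp.mpr (abs_le.mp (hf z)).2
  have hn' : ‖e'‖ ≤ Real.exp R := by
    change ‖(e' : C(closedDisc, ℂ))‖ ≤ _
    rw [ContinuousMap.norm_le _ (Real.exp_pos R).le]
    intro z
    rw [he', Complex.norm_exp]
    refine Real.exp_le_exp.mpr ?_
    change (-(f : C(closedDisc, ℂ)) z).re ≤ R
    rw [Complex.neg_re]
    linarith [(abs_le.mp (hf z)).1]
  rw [← h1, ← hD.apply_exp hes]
  refine (ContinuousLinearMap.le_opNorm _ _).trans ?_
  have := (D.le_opNorm e)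
  gcongr
  exact this.trans (by gcongr)

lemma norm_sum_functional_le {β : ℂ[X] →ₗ[ℂ] ℂ} {M M' r : ℝ}
    (hM : ∀ n, ‖β (X ^ n)‖ ≤ M)
    (hM' : ∀ W : ℂ[X], (∀ z : ℂ, ‖z‖ ≤ 1 → |(W.eval z).re| ≤ 5 / 4) → ‖β W‖ ≤ M')
    (hr0 : 0 ≤ r) (hr1 : r < 1) {L : ℕ} (hL : M * r ^ L / (1 - r) ≤ 1) (hL0 : L ≠ 0) {w : ℂ[X]}
    (hw : ∀ z : ℂ, ‖z‖ = 1 → |(w.eval z).re| ≤ 5 / 4) :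
    ‖∑ n ∈ Finset.range L, β (X ^ n) * r ^ n * w.coeff n‖ ≤ M' + 5 / 2 := by
  set W := w.comp (C (r : ℂ) * X)
  have h1 : ‖β W‖ ≤ M' := by
    refine hM' W fun z hz => ?_
    rw [eval_comp, eval_mul, eval_C, eval_X]
    refine abs_re_eval_le hw ?_
    rw [norm_mul, Complex.norm_real, Real.norm_of_nonneg hr0]
    exact mul_le_one₀ hr1.le (norm_nonneg _) hz
  have hWd : W.natDegree < L + w.natDegree + 1 := by
    refine lt_of_le_of_lt (natDegree_comp_le.trans ?_) (show w.natDegree < _ by omega)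
    have : (C (r : ℂ) * X).natDegree ≤ 1 := natDegree_mul_le.trans (by simp)
    simpa using Nat.mul_le_mul_left w.natDegree this
  have h2 : β W = ∑ n ∈ Finset.range (L + w.natDegree + 1), β (X ^ n) * r ^ n * w.coeff n := by
    conv_lhs => rw [W.as_sum_range_C_mul_X_pow' hWd]
    rw [map_sum]
    refine Finset.sum_congr rfl fun n _ => ?_
    rw [← smul_eq_C_mul, map_smul, comp_C_mul_X_coeff, smul_eq_mul]
    ring
  rw [add_assoc, Finset.sum_range_add] at h2
  have hr : 0 < 1 - r := by linarith
  have hM0 : 0 ≤ M := (norm_nonneg _).trans (hM 0)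
  have h3 : ‖∑ n ∈ Finset.range (w.natDegree + 1),
      β (X ^ (L + n)) * r ^ (L + n) * w.coeff (L + n)‖ ≤ 5 / 2 := by
    calc _ ≤ ∑ n ∈ Finset.range (w.natDegree + 1), M * r ^ L * (5 / 2) * r ^ n := by
          refine norm_sum_le_of_le _ fun n _ => ?_
          rw [norm_mul, norm_mul, norm_pow, Complex.norm_real, Real.norm_of_nonneg hr0]
          calc _ ≤ M * r ^ (L + n) * (2 * (5 / 4)) := by
                gcongr
                · exact hM _
                · exact norm_coeff_le_of_re_le hw (by omega)
            _ = _ := by rw [pow_add]; ring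
      _ ≤ M * r ^ L * (5 / 2) * (1 / (1 - r)) := by
          rw [← Finset.mul_sum]
          gcongr
          rw [geom_sum_eq (by linarith), ← neg_div_neg_eq, neg_sub, neg_sub]
          gcongr
          linarith [pow_nonneg hr0 (w.natDegree + 1)]
      _ = M * r ^ L / (1 - r) * (5 / 2) := by ring
      _ ≤ _ := by linarith
  have h4 : ∑ n ∈ Finset.range L, β (X ^ n) * r ^ n * w.coeff n = β W -
      ∑ n ∈ Finset.range (w.natDegree + 1),
        β (X ^ (L + n)) * r ^ (L + n) * w.coeff (L + n) := by
    rw [h2]; ring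
  rw [h4]
  exact (norm_sub_le _ _).trans (add_le_add h1 h3)

lemma half_norm_le {h : ℂ} {a b : ℝ} (ha : |a - (h / (‖h‖ + 1)).re| ≤ 1 / 4)
    (hb : |b - (h / (‖h‖ + 1)).im| ≤ 1 / 4) :
    ‖h‖ / 2 ≤ 1 + ((h * a).re + (h * b).im) := by
  have h0 := norm_nonneg h
  have e1 : (h / (‖h‖ + 1)).re = h.re / (‖h‖ + 1) := by
    rw [← Complex.ofReal_one, ← Complex.ofReal_add, Complex.div_ofReal_re]
  have e2 : (h / (‖h‖ + 1)).im = h.im / (‖h‖ + 1) := by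
    rw [← Complex.ofReal_one, ← Complex.ofReal_add, Complex.div_ofReal_im]
  rw [e1] at ha
  rw [e2] at hb
  rw [Complex.re_mul_ofReal, Complex.im_mul_ofReal]
  have h1 := Complex.abs_re_le_norm h
  have h2 := Complex.abs_im_le_norm h
  have h3 : ‖h‖ ^ 2 = h.re ^ 2 + h.im ^ 2 := by
    rw [Complex.sq_norm, Complex.normSq_apply]; ring
  have h4 : h.re * (h.re / (‖h‖ + 1)) + h.im * (h.im / (‖h‖ + 1)) = ‖h‖ ^ 2 / (‖h‖ + 1) := by
    rw [h3]; ring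
  have h5 : ‖h‖ - 1 ≤ ‖h‖ ^ 2 / (‖h‖ + 1) := by
    rw [le_div_iff₀ (by positivity)]; nlinarith
  have h6 : |h.re * (a - h.re / (‖h‖ + 1))| ≤ ‖h‖ * (1 / 4) := by
    rw [abs_mul]; gcongr
  have h7 : |h.im * (b - h.im / (‖h‖ + 1))| ≤ ‖h‖ * (1 / 4) := by
    rw [abs_mul]; gcongr
  have h8 := (abs_le.mp h6).1
  have h9 := (abs_le.mp h7).1
  rw [mul_sub] at h8 h9
  linarith

/-- Dilations of the coefficient sequence of a functional bounded on functions with small real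
part are bounded in mean. -/
lemma rootMean_norm_le_of_functional {β : ℂ[X] →ₗ[ℂ] ℂ} {M M' r : ℝ} (hβ : β 1 = 0)
    (hM : ∀ n, ‖β (X ^ n)‖ ≤ M)
    (hM' : ∀ W : ℂ[X], (∀ z : ℂ, ‖z‖ ≤ 1 → |(W.eval z).re| ≤ 5 / 4) → ‖β W‖ ≤ M')
    (hr0 : 0 ≤ r) (hr1 : r < 1) {L : ℕ} (hL : M * r ^ L / (1 - r) ≤ 1) (hL0 : L ≠ 0)
    {h : ℂ[X]} (hh : ∀ n, h.coeff n = if n < L then (starRingEnd ℂ) (β (X ^ n)) * r ^ n else 0) :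
    ∃ K₀ : ℕ, ∀ K ≥ K₀, rootMean K (fun z => ‖h.eval z‖) ≤ 2 * M' + 7 := by
  let q : C(Metric.sphere (0 : ℂ) 1, ℂ) :=
    ⟨fun z => h.eval (z : ℂ) / (‖h.eval (z : ℂ)‖ + 1), by
      have hc : Continuous fun z : Metric.sphere (0 : ℂ) 1 => h.eval (z : ℂ) :=
        h.continuous.comp continuous_subtype_val
      refine hc.div (by fun_prop) fun z => ?_
      rw [← Complex.ofReal_one, ← Complex.ofReal_add, Complex.ofReal_ne_zero]
      positivity⟩
  have hq : ∀ z, ‖q z‖ ≤ 1 := by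
    intro z
    change ‖h.eval (z : ℂ) / (‖h.eval (z : ℂ)‖ + 1)‖ ≤ 1
    rw [← Complex.ofReal_one, ← Complex.ofReal_add, norm_div, Complex.norm_real,
      Real.norm_of_nonneg (by positivity)]
    exact div_le_one_of_le₀ (by linarith) (by positivity)
  obtain ⟨w₁, hw₁⟩ := exists_polynomial_re_approx ⟨fun z => (q z).re, by fun_prop⟩
    (show (0 : ℝ) < 1 / 4 by norm_num)
  obtain ⟨w₂, hw₂⟩ := exists_polynomial_re_approx ⟨fun z => (q z).im, by fun_prop⟩
    (show (0 : ℝ) < 1 / 4 by norm_num)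
  have hb : ∀ w : ℂ[X], (∀ z : ℂ, ‖z‖ = 1 → |(w.eval z).re| ≤ 5 / 4) → ∀ K : ℕ,
      h.natDegree + w.natDegree + L < K →
      ‖rootMean K (fun z => h.eval z * ((w.eval z).re : ℂ))‖ ≤ (M' + 5 / 2) / 2 := by
    intro w hw K hK
    rw [rootMean_eval_mul_re (by omega), norm_div, Complex.norm_ofNat]
    · gcongr
      have : ∑ n ∈ Finset.range K, h.coeff n * (starRingEnd ℂ) (w.coeff n) =
          (starRingEnd ℂ) (∑ n ∈ Finset.range L, β (X ^ n) * r ^ n * w.coeff n) := by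
        have hsub : Finset.range L ⊆ Finset.range K := Finset.range_mono (by omega)
        rw [← Finset.sum_subset hsub, map_sum]
        · refine Finset.sum_congr rfl fun n hn => ?_
          rw [hh, if_pos (Finset.mem_range.mp hn), map_mul, map_mul, map_pow _ (r : ℂ),
            Complex.conj_ofReal]
        · intro n _ hn
          rw [hh, if_neg (by simpa using hn), zero_mul]
      rw [this, RCLike.norm_conj]
      exact norm_sum_functional_le hM hM' hr0 hr1 hL hL0 hw
    · rw [hh, if_pos (by omega), pow_zero, hβ, map_zero, zero_mul]
  have hs₁ : ∀ z : ℂ, ‖z‖ = 1 → |(w₁.eval z).re| ≤ 5 / 4 := by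
    intro z hz
    have h1 := hw₁ ⟨z, mem_sphere_zero_iff_norm.mpr hz⟩
    have h2 := (Complex.abs_re_le_norm _).trans (hq ⟨z, mem_sphere_zero_iff_norm.mpr hz⟩)
    simp only [ContinuousMap.coe_mk] at h1
    rw [abs_le] at *
    constructor <;> linarith
  have hs₂ : ∀ z : ℂ, ‖z‖ = 1 → |(w₂.eval z).re| ≤ 5 / 4 := by
    intro z hz
    have h1 := hw₂ ⟨z, mem_sphere_zero_iff_norm.mpr hz⟩
    have h2 := (Complex.abs_im_le_norm _).trans (hq ⟨z, mem_sphere_zero_iff_norm.mpr hz⟩)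
    simp only [ContinuousMap.coe_mk] at h1
    rw [abs_le] at *
    constructor <;> linarith
  refine ⟨h.natDegree + w₁.natDegree + w₂.natDegree + L + 1, fun K hK => ?_⟩
  have b1 := hb w₁ hs₁ K (by omega)
  have b2 := hb w₂ hs₂ K (by omega)
  have hpt : rootMean K (fun z => 2⁻¹ * ‖h.eval z‖) ≤ rootMean K (fun z => 1 +
      ((h.eval z * ((w₁.eval z).re : ℂ)).re + (h.eval z * ((w₂.eval z).re : ℂ)).im)) := by
    refine rootMean_mono fun z hz => ?_
    have h1 := hw₁ ⟨z, mem_sphere_zero_iff_norm.mpr hz⟩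
    have h2 := hw₂ ⟨z, mem_sphere_zero_iff_norm.mpr hz⟩
    rw [inv_mul_eq_div]
    exact half_norm_le h1 h2
  rw [rootMean_const_mul, rootMean_add, rootMean_add, rootMean_const (by omega)] at hpt
  have hre : ∀ F : ℂ → ℂ, rootMean K (fun z => (F z).re) = (rootMean K F).re := by
    intro F; simp [rootMean]
  have him : ∀ F : ℂ → ℂ, rootMean K (fun z => (F z).im) = (rootMean K F).im := by
    intro F; simp [rootMean]
  rw [hre, him] at hpt
  linarith [Complex.re_le_norm (rootMean K fun z => h.eval z * ((w₁.eval z).re : ℂ)),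
    (Complex.abs_im_le_norm (rootMean K fun z => h.eval z * ((w₂.eval z).re : ℂ))),
    le_abs_self (rootMean K fun z => h.eval z * ((w₂.eval z).re : ℂ)).im]

/-- An approximate `H²` factorization of a polynomial whose `H¹` norm is controlled. -/
lemma exists_approx_factorization {h : ℂ[X]} {B : ℝ} {K₀ : ℕ}
    (hB : ∀ K ≥ K₀, rootMean K (fun z => ‖h.eval z‖) ≤ B) {δ : ℝ} (hδ : 0 < δ) :
    ∃ a c : ℂ[X], coeffSq a ≤ 2 * Real.exp 1 * (B + 1) + 2 ∧
      coeffSq c ≤ 2 * Real.exp 1 * (B + 1) + 2 ∧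
      ∀ n, ‖(a * c).coeff n - h.coeff n‖ ≤ δ := by
  obtain ⟨w, hw⟩ := exists_polynomial_re_approx
    ⟨fun z => Real.log (‖h.eval (z : ℂ)‖ + 1), by
      have hc : Continuous fun z : Metric.sphere (0 : ℂ) 1 => ‖h.eval (z : ℂ)‖ + 1 :=
        (h.continuous.comp continuous_subtype_val).norm.add continuous_const
      exact hc.log fun z => by positivity⟩ one_pos
  set H := ‖polyToDisc h‖ + 1 with hH
  have hH1 : 1 ≤ H := by linarith [norm_nonneg (polyToDisc h)]
  have hhH : ∀ z : ℂ, ‖z‖ = 1 → ‖h.eval z‖ ≤ H := fun z hz =>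
    (norm_eval_le_norm_polyToDisc h hz.le).trans (by linarith)
  set G := Real.exp 1 * (H + 1) with hG
  have he1 : 1 ≤ Real.exp 1 := Real.one_le_exp zero_le_one
  have hG1 : 1 ≤ G := by nlinarith
  set η := min (1 / H) (δ / (H * (2 * G + 1))) with hη
  have hη0 : 0 < η := lt_min (by positivity) (by positivity)
  have hηH : H * η ≤ 1 := by
    calc H * η ≤ H * (1 / H) := by gcongr; exact min_le_left _ _
      _ = 1 := by field_simp
  have hη1 : η ≤ 1 := by nlinarith
  have hηδ : H * (η * (2 * G + 1)) ≤ δ := by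
    calc H * (η * (2 * G + 1)) = η * (H * (2 * G + 1)) := by ring
      _ ≤ δ / (H * (2 * G + 1)) * (H * (2 * G + 1)) := by gcongr; exact min_le_right _ _
      _ = δ := by field_simp
  obtain ⟨p, hp⟩ := exists_polynomial_exp_approx (C (1 / 2) * w) hη0
  obtain ⟨q, hq⟩ := exists_polynomial_exp_approx (C (-(1 / 2)) * w) hη0
  have hre : ∀ z : ℂ, ‖z‖ = 1 →
      ‖Complex.exp ((C (1 / 2) * w).eval z)‖ ^ 2 ≤ Real.exp 1 * (‖h.eval z‖ + 1) ∧
      ‖Complex.exp ((C (-(1 / 2)) * w).eval z)‖ ^ 2 ≤ Real.exp 1 / (‖h.eval z‖ + 1) := by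
    intro z hz
    have h1 := abs_le.mp (hw ⟨z, mem_sphere_zero_iff_norm.mpr hz⟩)
    simp only [ContinuousMap.coe_mk] at h1
    have h0 : 0 < ‖h.eval z‖ + 1 := by positivity
    constructor
    · rw [Complex.norm_exp, ← Real.exp_nat_mul, ← Real.exp_log h0, ← Real.exp_add]
      apply Real.exp_le_exp.mpr
      have : ((C (1 / 2) * w).eval z).re = 1 / 2 * (w.eval z).re := by
        rw [eval_mul, eval_C, Complex.mul_re]; norm_num
      rw [this]
      push_cast
      linarith
    · rw [Complex.norm_exp, ← Real.exp_nat_mul, ← Real.exp_log h0, ← Real.exp_sub]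
      apply Real.exp_le_exp.mpr
      have : ((C (-(1 / 2)) * w).eval z).re = -(1 / 2) * (w.eval z).re := by
        rw [eval_mul, eval_C, Complex.mul_re]; norm_num
      rw [this]
      push_cast
      linarith
  have hsq : ∀ x y : ℂ, ‖x - y‖ ≤ η → ‖x‖ ^ 2 ≤ 2 * ‖y‖ ^ 2 + 2 * η ^ 2 := by
    intro x y hxy
    have h1 : ‖x‖ ≤ ‖y‖ + η := by
      calc ‖x‖ = ‖y + (x - y)‖ := by rw [add_sub_cancel]
        _ ≤ ‖y‖ + ‖x - y‖ := norm_add_le _ _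
        _ ≤ _ := by gcongr
    nlinarith [norm_nonneg x, sq_nonneg (‖y‖ - η)]
  have hmean : ∀ s : ℂ[X], (∀ z : ℂ, ‖z‖ = 1 →
      ‖s.eval z‖ ^ 2 ≤ 2 * Real.exp 1 * (‖h.eval z‖ + 1) + 2) →
      coeffSq s ≤ 2 * Real.exp 1 * (B + 1) + 2 := by
    intro s hs
    set K := K₀ + s.natDegree + 1
    rw [← rootMean_norm_sq (show s.natDegree < K by omega)]
    refine (rootMean_mono hs).trans ?_
    rw [rootMean_add, rootMean_const_mul, rootMean_add, rootMean_const (by omega),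
      rootMean_const (by omega)]
    gcongr
    exact hB K (by omega)
  refine ⟨p, h * q, hmean p fun z hz => ?_, hmean _ fun z hz => ?_, fun n => ?_⟩
  · have h1 := hsq _ _ (hp z hz.le)
    have h2 := (hre z hz).1
    nlinarith
  · have h1 := hsq _ _ (hq z hz.le)
    have h2 := (hre z hz).2
    have h3 := norm_nonneg (h.eval z)
    rw [eval_mul, norm_mul, mul_pow]
    calc ‖h.eval z‖ ^ 2 * ‖q.eval z‖ ^ 2
        ≤ ‖h.eval z‖ ^ 2 * (2 * (Real.exp 1 / (‖h.eval z‖ + 1)) + 2 * η ^ 2) := by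
          gcongr; linarith
      _ = 2 * Real.exp 1 * (‖h.eval z‖ ^ 2 / (‖h.eval z‖ + 1)) + 2 * (‖h.eval z‖ * η) ^ 2 := by
          ring
      _ ≤ 2 * Real.exp 1 * (‖h.eval z‖ + 1) + 2 * 1 ^ 2 := by
          gcongr
          · rw [div_le_iff₀ (by positivity)]; nlinarith
          · exact (mul_le_mul_of_nonneg_right (hhH z hz) hη0.le).trans hηH
      _ = _ := by ring
  · rw [← coeff_sub]
    refine norm_coeff_le (fun z hz => ?_) n
    set e₁ := Complex.exp ((C (1 / 2) * w).eval z) with h_e₁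
    set e₂ := Complex.exp ((C (-(1 / 2)) * w).eval z) with h_e₂
    have h12 : e₁ * e₂ = 1 := by
      rw [h_e₁, h_e₂, ← Complex.exp_add, ← eval_add, ← add_mul, ← C_add]
      simp
    have hle : ∀ x : ℝ, 0 ≤ x → x ^ 2 ≤ G → x ≤ G := fun x _ hx => by nlinarith
    have hb₁ : ‖e₁‖ ≤ G := by
      refine hle _ (norm_nonneg _) ((hre z hz).1.trans ?_)
      rw [hG]; gcongr; exact hhH z hz
    have hb₂ : ‖e₂‖ ≤ G := by
      refine hle _ (norm_nonneg _) ((hre z hz).2.trans ?_)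
      refine (div_le_self (by positivity) (by linarith [norm_nonneg (h.eval z)])).trans ?_
      rw [hG]
      nlinarith
    have hp1 : ‖p.eval z‖ ≤ G + 1 := by
      calc ‖p.eval z‖ = ‖e₁ + (p.eval z - e₁)‖ := by rw [add_sub_cancel]
        _ ≤ ‖e₁‖ + ‖p.eval z - e₁‖ := norm_add_le _ _
        _ ≤ _ := add_le_add hb₁ ((hp z hz.le).trans hη1)
    calc ‖(p * (h * q) - h).eval z‖
        = ‖h.eval z‖ * ‖p.eval z * (q.eval z - e₂) + (p.eval z - e₁) * e₂‖ := by
          rw [← norm_mul, eval_sub, eval_mul, eval_mul]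
          congr 1
          linear_combination (h.eval z) * h12
      _ ≤ H * ((G + 1) * η + η * G) := by
          gcongr
          · exact hhH z hz
          · refine (norm_add_le _ _).trans ?_
            rw [norm_mul, norm_mul]
            gcongr
            · exact hq z hz.le
            · exact hp z hz.le
      _ = H * (η * (2 * G + 1)) := by ring
      _ ≤ δ := hηδ

lemma sum_norm_coeff_sq_le (p : ℂ[X]) (K : ℕ) :
    ∑ n ∈ Finset.range K, ‖p.coeff n‖ ^ 2 ≤ coeffSq p := by
  rw [coeffSq_eq_sum_range (show p.natDegree < K + p.natDegree + 1 by omega), add_assoc,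
    Finset.sum_range_add]
  exact le_add_of_nonneg_right (by positivity)

lemma exists_polynomial_coeff_eq (u : ℕ → ℂ) (L : ℕ) :
    ∃ p : ℂ[X], ∀ n, p.coeff n = if n < L then u n else 0 :=
  ⟨∑ n ∈ Finset.range L, C (u n) * X ^ n, fun n => by
    simp only [finsetSum_coeff, coeff_C_mul, coeff_X_pow, mul_ite, mul_one, mul_zero,
      Finset.sum_ite_eq, Finset.mem_range]⟩

/-- A functional that is bounded on functions with small real part is represented by the
product of two square-summable power series. -/
lemma exists_l2_factorization {β : ℂ[X] →ₗ[ℂ] ℂ} {M M' : ℝ} (hβ : β 1 = 0)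
    (hM : ∀ n, ‖β (X ^ n)‖ ≤ M)
    (hM' : ∀ W : ℂ[X], (∀ z : ℂ, ‖z‖ ≤ 1 → |(W.eval z).re| ≤ 5 / 4) → ‖β W‖ ≤ M') :
    ∃ (B : ℝ) (a c : ℕ → ℂ), (∀ K, ∑ n ∈ Finset.range K, ‖a n‖ ^ 2 ≤ B) ∧
      (∀ K, ∑ n ∈ Finset.range K, ‖c n‖ ^ 2 ≤ B) ∧
      ∀ n, ∑ x ∈ Finset.HasAntidiagonal.antidiagonal n, a x.1 * c x.2 = (starRingEnd ℂ) (β (X ^ n)) := by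
  set B := 2 * Real.exp 1 * (2 * M' + 7 + 1) + 2 with hB
  have hstep : ∀ k : ℕ, ∃ (L : ℕ) (a c : ℂ[X]), k < L ∧ coeffSq a ≤ B ∧ coeffSq c ≤ B ∧
      ∀ n, ‖(a * c).coeff n - if n < L then
        (starRingEnd ℂ) (β (X ^ n)) * (((1 - 1 / ((k : ℝ) + 1) : ℝ) : ℂ)) ^ n else 0‖
          ≤ 1 / ((k : ℝ) + 1) := by
    intro k
    have hk : (0 : ℝ) < 1 / ((k : ℝ) + 1) := by positivity
    have hk1 : 1 / ((k : ℝ) + 1) ≤ 1 := by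
      rw [div_le_one (by positivity)]; linarith [k.cast_nonneg (α := ℝ)]
    set r : ℝ := 1 - 1 / ((k : ℝ) + 1)
    have hr0 : 0 ≤ r := by linarith
    have hr1 : r < 1 := by linarith
    have ht : Filter.Tendsto (fun L : ℕ => M * r ^ L / (1 - r)) Filter.atTop (nhds 0) := by
      simpa using ((tendsto_pow_atTop_nhds_zero_of_lt_one hr0 hr1).const_mul M).div_const (1 - r)
    obtain ⟨L, hL, hkL⟩ := ((ht.eventually_le_const one_pos).and
      (Filter.eventually_gt_atTop k)).exists
    obtain ⟨h, hh⟩ := exists_polynomial_coeff_eq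
      (fun n => (starRingEnd ℂ) (β (X ^ n)) * (r : ℂ) ^ n) L
    obtain ⟨K₀, hK₀⟩ := rootMean_norm_le_of_functional (L := L) hβ hM hM' hr0 hr1 hL (by omega)
      hh
    obtain ⟨a, c, ha, hc, hac⟩ := exists_approx_factorization hK₀ hk
    refine ⟨L, a, c, hkL, ha, hc, fun n => ?_⟩
    rw [← hh]
    exact hac n
  choose L a c hkL ha hc hac using hstep
  have hbound : ∀ p : ℂ[X], coeffSq p ≤ B → ∀ n, ‖p.coeff n‖ ≤ B + 1 := by
    intro p hp n
    have h1 := Finset.single_le_sum (f := fun n => ‖p.coeff n‖ ^ 2) (fun n _ => by positivity)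
      (Finset.self_mem_range_succ n)
    have h2 := h1.trans ((sum_norm_coeff_sq_le p (n + 1)).trans hp)
    change ‖p.coeff n‖ ^ 2 ≤ B at h2
    nlinarith [sq_nonneg (‖p.coeff n‖ - 1)]
  have hcpt : IsCompact (Set.univ.pi fun _ : ℕ => Metric.closedBall (0 : ℂ × ℂ) (B + 1)) :=
    isCompact_univ_pi fun _ => isCompact_closedBall _ _
  obtain ⟨x, -, φ, hφ, hx⟩ := hcpt.tendsto_subseq
    (x := fun k n => ((a k).coeff n, (c k).coeff n)) fun k n _ => by
      rw [mem_closedBall_zero_iff, Prod.norm_def]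
      exact max_le (hbound _ (ha k) n) (hbound _ (hc k) n)
  rw [tendsto_pi_nhds] at hx
  have hxa : ∀ n, Filter.Tendsto (fun k => (a (φ k)).coeff n) Filter.atTop (nhds (x n).1) :=
    fun n => (hx n).fst_nhds
  have hxc : ∀ n, Filter.Tendsto (fun k => (c (φ k)).coeff n) Filter.atTop (nhds (x n).2) :=
    fun n => (hx n).snd_nhds
  refine ⟨B, fun n => (x n).1, fun n => (x n).2, fun K => ?_, fun K => ?_, fun n => ?_⟩
  · exact le_of_tendsto' (tendsto_finsetSum _ fun n _ => (hxa n).norm.pow 2)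
      fun k => (sum_norm_coeff_sq_le _ _).trans (ha _)
  · exact le_of_tendsto' (tendsto_finsetSum _ fun n _ => (hxc n).norm.pow 2)
      fun k => (sum_norm_coeff_sq_le _ _).trans (hc _)
  · have h1 : Filter.Tendsto (fun k => (a (φ k) * c (φ k)).coeff n) Filter.atTop
        (nhds (∑ y ∈ Finset.HasAntidiagonal.antidiagonal n, (x y.1).1 * (x y.2).2)) := by
      simp only [coeff_mul]
      exact tendsto_finsetSum _ fun y _ => (hxa y.1).mul (hxc y.2)
    have h2 : Filter.Tendsto (fun k => (a k * c k).coeff n) Filter.atTop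
        (nhds ((starRingEnd ℂ) (β (X ^ n)))) := by
      have h3 : Filter.Tendsto (fun k : ℕ => (starRingEnd ℂ) (β (X ^ n)) *
          (((1 - 1 / ((k : ℝ) + 1) : ℝ) : ℂ)) ^ n) Filter.atTop
          (nhds ((starRingEnd ℂ) (β (X ^ n)))) := by
        have h4 : Filter.Tendsto (fun k : ℕ => ((1 - 1 / ((k : ℝ) + 1) : ℝ) : ℂ)) Filter.atTop
            (nhds ((1 - 0 : ℝ) : ℂ)) :=
          (Complex.continuous_ofReal.tendsto _).comp
            (tendsto_const_nhds.sub tendsto_one_div_add_atTop_nhds_zero_nat)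
        simpa using (h4.pow n).const_mul ((starRingEnd ℂ) (β (X ^ n)))
      have h5 : Filter.Tendsto (fun k : ℕ => (a k * c k).coeff n - (starRingEnd ℂ) (β (X ^ n)) *
          (((1 - 1 / ((k : ℝ) + 1) : ℝ) : ℂ)) ^ n) Filter.atTop (nhds 0) := by
        refine squeeze_zero_norm' ?_ tendsto_one_div_add_atTop_nhds_zero_nat
        filter_upwards [Filter.eventually_ge_atTop n] with k hk
        have := hac k n
        rwa [if_pos (hk.trans_lt (hkL k))] at this
      simpa using h5.add h3
    exact tendsto_nhds_unique h1 (h2.comp hφ.tendsto_atTop)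

/-- Finitely supported Hankel-type forms are compact. -/
lemma exists_isCompactOperator_form (m : ℕ → ℂ) (N : ℕ) :
    ∃ T : discAlgebra →L[ℂ] DADual, IsCompactOperator T ∧ ∀ f g : ℂ[X],
      T (polyToDisc f) (polyToDisc g) =
        ∑ l ∈ Finset.range N, (derivative f * g).coeff l * m l := by
  choose ℓ hℓ using exists_coeff_functional
  have hrank : ∀ i j, IsCompactOperator ((ℓ i).smulRight (ℓ j)) := by
    intro i j
    have h1 : IsCompactOperator (ContinuousLinearMap.toSpanSingleton ℂ (ℓ j)) :=
      isCompactOperator_of_locallyCompactSpace_rng _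
    exact h1.comp_clm (ℓ i)
  refine ⟨∑ l ∈ Finset.range N, ∑ x ∈ Finset.HasAntidiagonal.antidiagonal l,
    (m l * (x.1 + 1)) • (ℓ (x.1 + 1)).smulRight (ℓ x.2), ?_, fun f g => ?_⟩
  · exact Submodule.sum_mem (compactOperator (RingHom.id ℂ) discAlgebra DADual) fun l _ =>
      Submodule.sum_mem _ fun x _ => (hrank _ _).smul (m l * (x.1 + 1))
  · simp only [sum_apply, smul_apply,
      ContinuousLinearMap.smulRight_apply, hℓ, smul_eq_mul]
    refine Finset.sum_congr rfl fun l _ => ?_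
    rw [coeff_mul, Finset.sum_mul]
    refine Finset.sum_congr rfl fun x _ => ?_
    rw [coeff_derivative]
    ring

lemma norm_le_of_polynomial_bound {S : discAlgebra →L[ℂ] DADual} {η : ℝ} (hη : 0 ≤ η)
    (hS : ∀ f g : ℂ[X], (∀ z : ℂ, ‖z‖ ≤ 1 → ‖f.eval z‖ ≤ 1) →
      (∀ z : ℂ, ‖z‖ ≤ 1 → ‖g.eval z‖ ≤ 1) → ‖S (polyToDisc f) (polyToDisc g)‖ ≤ η) :
    ‖S‖ ≤ η := by
  have hscale : ∀ p : ℂ[X], ∃ q : ℂ[X], (∀ z : ℂ, ‖z‖ ≤ 1 → ‖q.eval z‖ ≤ 1) ∧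
      polyToDisc p = (‖polyToDisc p‖ : ℂ) • polyToDisc q := by
    intro p
    rcases eq_or_ne (polyToDisc p) 0 with h | h
    · exact ⟨0, fun z _ => by simp, by simp [h]⟩
    · have h0 : (‖polyToDisc p‖ : ℂ) ≠ 0 := by exact_mod_cast norm_ne_zero_iff.mpr h
      refine ⟨(‖polyToDisc p‖ : ℂ)⁻¹ • p, fun z hz => ?_, by rw [map_smul, smul_inv_smul₀ h0]⟩
      rw [eval_smul, norm_smul, norm_inv, Complex.norm_real, norm_norm, inv_mul_eq_div]
      exact div_le_one_of_le₀ (norm_eval_le_norm_polyToDisc p hz) (norm_nonneg _)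
  have key : ∀ f g : discAlgebra, ‖S f g‖ ≤ η * ‖f‖ * ‖g‖ := by
    refine isClosed_property2 denseRange_polyToDisc (isClosed_le ?_ ?_) fun p q => ?_
    · exact ((S.continuous.comp continuous_fst).clm_apply continuous_snd).norm
    · fun_prop
    · obtain ⟨p', hp', hp⟩ := hscale p
      obtain ⟨q', hq', hq⟩ := hscale q
      have h1 : ‖S (polyToDisc p) (polyToDisc q)‖ =
          ‖polyToDisc p‖ * (‖polyToDisc q‖ * ‖S (polyToDisc p') (polyToDisc q')‖) := by
        conv_lhs => rw [hp, hq]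
        rw [map_smul, map_smul, smul_apply, norm_smul, norm_smul,
          Complex.norm_real, Complex.norm_real, norm_norm, norm_norm]
        ring
      rw [h1]
      calc _ ≤ ‖polyToDisc p‖ * (‖polyToDisc q‖ * η) := by gcongr; exact hS p' q' hp' hq'
        _ = _ := by ring
  refine S.opNorm_le_bound hη fun f => ?_
  exact (S f).opNorm_le_bound (by positivity) fun g => key f g

/-- The bounded functional `p ↦ D(p)(1)` attached to a derivation. -/
def polyFunctional (D : discAlgebra →L[ℂ] DADual) : ℂ[X] →ₗ[ℂ] ℂ where
  toFun p := D (polyToDisc p) 1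
  map_add' p q := by rw [map_add, map_add, add_apply]
  map_smul' c p := by rw [map_smul, map_smul, smul_apply, RingHom.id_apply]

lemma polyFunctional_apply (D : discAlgebra →L[ℂ] DADual) (p : ℂ[X]) :
    polyFunctional D p = D (polyToDisc p) 1 := rfl

lemma polyToDisc_X : polyToDisc X = discCoord := aeval_X _

lemma norm_polyFunctional_X_pow_le (D : discAlgebra →L[ℂ] DADual) (n : ℕ) :
    ‖polyFunctional D (X ^ n)‖ ≤ ‖D‖ := by
  rw [polyFunctional_apply, map_pow, polyToDisc_X]
  calc ‖D (discCoord ^ n) 1‖ ≤ ‖D‖ * ‖discCoord ^ n‖ * ‖(1 : discAlgebra)‖ := D.le_opNorm₂ _ _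
    _ ≤ ‖D‖ * 1 * 1 := by
        have h1 : ‖(1 : discAlgebra)‖ ≤ 1 := by
          have := norm_discCoord_pow_le 0
          rwa [pow_zero] at this
        gcongr
        exact norm_discCoord_pow_le n
    _ = ‖D‖ := by ring

lemma IsDerivation.apply_polyToDisc {D : discAlgebra →L[ℂ] DADual} (hD : IsDerivation D)
    (f : ℂ[X]) (u : discAlgebra) :
    D (polyToDisc f) u = D discCoord (polyToDisc (derivative f) * u) := by
  induction f using Polynomial.induction_on' with
  | add p q hp hq =>
    rw [map_add, map_add, add_apply, hp, hq, derivative_add, map_add, add_mul,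
      map_add]
  | monomial n b =>
    rw [derivative_monomial, ← C_mul_X_pow_eq_monomial, ← C_mul_X_pow_eq_monomial,
      ← smul_eq_C_mul, ← smul_eq_C_mul, map_smul, map_smul, map_smul, map_pow polyToDisc,
      map_pow polyToDisc, polyToDisc_X, smul_apply, smul_mul_assoc, map_smul]
    cases n with
    | zero => simp [hD.apply_one]
    | succ n =>
      rw [hD.apply_pow, Nat.add_sub_cancel, smul_eq_mul, smul_eq_mul]
      push_cast
      ring

lemma IsDerivation.apply_polyToDisc_polyToDisc {D : discAlgebra →L[ℂ] DADual}
    (hD : IsDerivation D) (f g : ℂ[X]) {L : ℕ} (hL : (derivative f * g).natDegree < L) :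
    D (polyToDisc f) (polyToDisc g) = ∑ l ∈ Finset.range L,
      (derivative f * g).coeff l * polyFunctional D (X ^ (l + 1)) / (l + 1) := by
  rw [hD.apply_polyToDisc, ← map_mul]
  conv_lhs => rw [(derivative f * g).as_sum_range_C_mul_X_pow' hL]
  rw [map_sum, map_sum]
  refine Finset.sum_congr rfl fun l _ => ?_
  have hl : (l : ℂ) + 1 ≠ 0 := by exact_mod_cast Nat.succ_ne_zero l
  rw [← smul_eq_C_mul, map_smul, map_smul, map_pow polyToDisc, polyFunctional_apply,
    map_pow polyToDisc, polyToDisc_X,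
    hD.apply_pow, mul_one, smul_eq_mul]
  field_simp

lemma coeffSq_smul (t : ℂ) (p : ℂ[X]) : coeffSq (t • p) = ‖t‖ ^ 2 * coeffSq p := by
  set K := (t • p).natDegree + p.natDegree + 1
  rw [coeffSq_eq_sum_range (show (t • p).natDegree < K by omega),
    coeffSq_eq_sum_range (show p.natDegree < K by omega), Finset.mul_sum]
  refine Finset.sum_congr rfl fun n _ => ?_
  rw [coeff_smul, norm_smul, mul_pow]

lemma norm_sum_coeff_derivative_mul_le_weighted {f g a c : ℂ[X]}
    (hf : ∀ z : ℂ, ‖z‖ ≤ 1 → ‖f.eval z‖ ≤ 1) (hg : ∀ z : ℂ, ‖z‖ ≤ 1 → ‖g.eval z‖ ≤ 1)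
    {L : ℕ} (hL : (derivative f * g).natDegree < L) {t : ℝ} (ht : 0 < t) :
    ‖∑ l ∈ Finset.range L, (derivative f * g).coeff l *
      (starRingEnd ℂ) ((a * c).coeff (l + 1)) / (l + 1)‖ ≤
        5 / 2 * (t ^ 2 * coeffSq a + coeffSq c / t ^ 2) := by
  have h := norm_sum_coeff_derivative_mul_le (a := (t : ℂ) • a) (c := (t : ℂ)⁻¹ • c) hf hg hL
  have ht' : (t : ℂ) ≠ 0 := by exact_mod_cast ht.ne'
  rw [smul_mul_smul_comm, mul_inv_cancel₀ ht', one_smul, coeffSq_smul, coeffSq_smul, norm_inv,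
    Complex.norm_real, Real.norm_of_nonneg ht.le, inv_pow, inv_mul_eq_div] at h
  exact h

lemma coeffSq_truncation {u : ℕ → ℂ} {p : ℂ[X]} {J : ℕ}
    (hp : ∀ n, p.coeff n = if n < J then u n else 0) :
    coeffSq p = ∑ n ∈ Finset.range J, ‖u n‖ ^ 2 := by
  rw [coeffSq_eq_sum_range (show p.natDegree < J + p.natDegree + 1 by omega), add_assoc,
    Finset.sum_range_add, Finset.sum_eq_zero (s := Finset.range (p.natDegree + 1)), add_zero]
  · exact Finset.sum_congr rfl fun n hn => by rw [hp, if_pos (Finset.mem_range.mp hn)]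
  · intro n _
    rw [hp, if_neg (by omega), norm_zero, sq, zero_mul]

lemma coeffSq_truncation_sub {u : ℕ → ℂ} {p q : ℂ[X]} {J K : ℕ} (hKJ : K ≤ J)
    (hp : ∀ n, p.coeff n = if n < J then u n else 0)
    (hq : ∀ n, q.coeff n = if n < K then u n else 0) :
    coeffSq (p - q) = ∑ n ∈ Finset.range J, ‖u n‖ ^ 2 - ∑ n ∈ Finset.range K, ‖u n‖ ^ 2 := by
  rw [coeffSq_truncation (u := fun n => if n < K then 0 else u n) (J := J) fun n => by
    rw [coeff_sub, hp, hq]; split_ifs <;> first | omega | simp]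
  obtain ⟨i, rfl⟩ := Nat.exists_eq_add_of_le hKJ
  rw [Finset.sum_range_add, Finset.sum_range_add, add_sub_cancel_left,
    Finset.sum_eq_zero fun n hn => by simp [Finset.mem_range.mp hn], zero_add]
  exact Finset.sum_congr rfl fun n _ => by rw [if_neg (by omega)]

lemma eventually_sum_range_sub_le {u : ℕ → ℂ} {B : ℝ}
    (hu : ∀ K, ∑ n ∈ Finset.range K, ‖u n‖ ^ 2 ≤ B) {ε : ℝ} (hε : 0 < ε) :
    ∀ᶠ K in Filter.atTop, ∀ J,
      ∑ n ∈ Finset.range J, ‖u n‖ ^ 2 - ∑ n ∈ Finset.range K, ‖u n‖ ^ 2 ≤ ε := by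
  have hs : Summable fun n => ‖u n‖ ^ 2 :=
    summable_of_sum_range_le (fun n => by positivity) hu
  filter_upwards [hs.hasSum.tendsto_sum_nat.eventually_const_le
    (show (∑' n, ‖u n‖ ^ 2) - ε < ∑' n, ‖u n‖ ^ 2 by linarith)] with K hK J
  have := hs.sum_le_tsum (Finset.range J) fun n _ => by positivity
  linarith

/-- Every bounded derivation from the disc algebra to its dual is a compact
operator. -/
theorem derivation_isCompactOperator
    (D : ↥discAlgebra →L[ℂ] DADual) (hD : IsDerivation D) :
    IsCompactOperator ⇑D := by
  obtain ⟨B, a, c, ha, hc, hac⟩ := exists_l2_factorization (β := polyFunctional D)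
    (M := ‖D‖) (M' := ‖D‖ * Real.exp (5 / 4) * Real.exp (5 / 4))
    (by rw [polyFunctional_apply, map_one polyToDisc, hD.apply_one]) (norm_polyFunctional_X_pow_le D)
    (fun W hW => hD.norm_apply_one_le fun z => by
      rw [polyToDisc_apply]; exact hW z (mem_closedBall_zero_iff.mp z.2))
  have hB : 0 ≤ B := by simpa using ha 0
  suffices hmem : D ∈ closure {T : discAlgebra →L[ℂ] DADual | IsCompactOperator T} by
    rwa [isClosed_setOfPred_isCompactOperator.closure_eq] at hmem
  refine (Metric.mem_closure_iff (α := discAlgebra →L[ℂ] DADual)).mpr fun η hη => ?_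
  set t : ℝ := Real.sqrt (10 * (B + 1) / η * 2) with ht_def
  have ht : 0 < t := Real.sqrt_pos.mpr (by positivity)
  have ht2 : t ^ 2 = 10 * (B + 1) / η * 2 := Real.sq_sqrt (by positivity)
  have htB : 5 / 2 * (B / t ^ 2) ≤ η / 8 := by
    rw [ht2]
    have : B / (10 * (B + 1) / η * 2) ≤ η / 20 := by
      rw [div_le_iff₀ (by positivity)]
      have : η / 20 * (10 * (B + 1) / η * 2) = B + 1 := by field_simp; ring
      linarith
    linarith
  set ε := η / (20 * t ^ 2) with hε_def
  have hε : 0 < ε := by positivity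
  have hεt : 5 / 2 * (t ^ 2 * ε) ≤ η / 8 := by
    rw [hε_def]
    exact le_of_eq (by field_simp; ring)
  obtain ⟨K, hKa, hKc⟩ := ((eventually_sum_range_sub_le ha hε).and
    (eventually_sum_range_sub_le hc hε)).exists
  obtain ⟨aK, haK⟩ := exists_polynomial_coeff_eq a K
  obtain ⟨cK, hcK⟩ := exists_polynomial_coeff_eq c K
  set N := (aK * cK).natDegree + 1
  obtain ⟨T, hT, hTfg⟩ := exists_isCompactOperator_form
    (fun l => (starRingEnd ℂ) ((aK * cK).coeff (l + 1)) / (l + 1)) N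
  refine ⟨T, hT, ?_⟩
  refine lt_of_eq_of_lt (dist_eq_norm D T) ?_
  refine lt_of_le_of_lt (norm_le_of_polynomial_bound (half_pos hη).le fun f g hf hg => ?_)
    (half_lt_self hη)
  set L := (derivative f * g).natDegree + N + 1 with hL_def
  have hL : (derivative f * g).natDegree < L := by omega
  set J := K + L + 1 with hJ_def
  obtain ⟨aJ, haJ⟩ := exists_polynomial_coeff_eq a J
  obtain ⟨cJ, hcJ⟩ := exists_polynomial_coeff_eq c J
  have hcoeff : ∀ l ∈ Finset.range L, polyFunctional D (X ^ (l + 1)) =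
      (starRingEnd ℂ) ((aJ * cJ).coeff (l + 1)) := by
    intro l hl
    rw [← Complex.conj_conj (polyFunctional D _), ← hac, coeff_mul]
    congr 1
    refine Finset.sum_congr rfl fun x hx => ?_
    have h1 := Finset.HasAntidiagonal.mem_antidiagonal.mp hx
    have h2 := Finset.mem_range.mp hl
    rw [haJ, hcJ, if_pos (by omega), if_pos (by omega)]
  have hTL : T (polyToDisc f) (polyToDisc g) = ∑ l ∈ Finset.range L,
      (derivative f * g).coeff l * ((starRingEnd ℂ) ((aK * cK).coeff (l + 1)) / (l + 1)) := by
    rw [hTfg]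
    refine Finset.sum_subset (Finset.range_mono (by omega)) fun l _ hl => ?_
    rw [coeff_eq_zero_of_natDegree_lt (p := aK * cK) (by
      have := Finset.mem_range.not.mp hl; omega)]
    simp
  have hsplit : (D - T) (polyToDisc f) (polyToDisc g) =
      ∑ l ∈ Finset.range L, (derivative f * g).coeff l *
        (starRingEnd ℂ) (((aJ - aK) * cJ).coeff (l + 1)) / (l + 1) +
      ∑ l ∈ Finset.range L, (derivative f * g).coeff l *
        (starRingEnd ℂ) (((cJ - cK) * aK).coeff (l + 1)) / (l + 1) := by
    rw [sub_apply, sub_apply,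
      hD.apply_polyToDisc_polyToDisc f g hL, hTL, ← Finset.sum_sub_distrib,
      ← Finset.sum_add_distrib]
    refine Finset.sum_congr rfl fun l hl => ?_
    rw [hcoeff l hl, show (aJ - aK) * cJ = aJ * cJ - aK * cJ by ring,
      show (cJ - cK) * aK = aK * cJ - aK * cK by ring, coeff_sub, coeff_sub, map_sub, map_sub]
    ring
  have b1 := norm_sum_coeff_derivative_mul_le_weighted (a := aJ - aK) (c := cJ) hf hg hL ht
  have b2 := norm_sum_coeff_derivative_mul_le_weighted (a := cJ - cK) (c := aK) hf hg hL ht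
  have e1 : coeffSq (aJ - aK) ≤ ε := by
    rw [coeffSq_truncation_sub (by omega) haJ haK]; exact hKa J
  have e2 : coeffSq (cJ - cK) ≤ ε := by
    rw [coeffSq_truncation_sub (by omega) hcJ hcK]; exact hKc J
  have e3 : coeffSq cJ ≤ B := by rw [coeffSq_truncation hcJ]; exact hc J
  have e4 : coeffSq aK ≤ B := by rw [coeffSq_truncation haK]; exact ha K
  have hfin : ∀ x y : ℝ, x ≤ ε → y ≤ B → 5 / 2 * (t ^ 2 * x + y / t ^ 2) ≤ η / 4 := by
    intro x y hx hy
    have h1 : t ^ 2 * x ≤ t ^ 2 * ε := by gcongr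
    have h2 : y / t ^ 2 ≤ B / t ^ 2 := by gcongr
    linarith
  rw [hsplit]
  refine (norm_add_le _ _).trans ?_
  linarith [hfin _ _ e1 e3, hfin _ _ e2 e4]

end
end

section
/- Let k be holomorphic on an open set containing the closed unit disc Δ with k(0) = 0. Then for all analytic polynomials f and g, with u the unique polynomial satisfying u(0) = 0 and u' = f'g, one has |∫_𝕋 u(z) conj(k(z)²) |dz|| ≤ 8 ‖f‖_∞ ‖g‖_∞ ∫_𝕋 |k(z)|² |dz|, where ‖·‖_∞ is the supremum norm over Δ and conj denotes complex conjugation. -/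
open Complex MeasureTheory Metric Real

set_option synthInstance.maxHeartbeats 400000
set_option maxHeartbeats 1000000

noncomputable section

section

open Polynomial Filter Topology

/-- The rectangle `[0, 1] × [0, 2π]` of polar coordinates of the closed unit disc. -/
abbrev polarRect : Set (ℝ × ℝ) := Set.Icc 0 1 ×ˢ Set.Icc 0 (2 * Real.pi)

/-- The point of the plane with polar coordinates `p`. -/
abbrev polarPt (p : ℝ × ℝ) : ℂ := p.1 * Complex.exp (p.2 * Complex.I)

theorem norm_polarPt_le {p : ℝ × ℝ} (hp : p ∈ polarRect) : ‖polarPt p‖ ≤ 1 := by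
  rw [polarPt, norm_mul, Complex.norm_exp_ofReal_mul_I, mul_one, Complex.norm_real,
    Real.norm_of_nonneg hp.1.1]
  exact hp.1.2

theorem integrableOn_polarRect {E : Type*} [NormedAddCommGroup E] {h : ℝ × ℝ → E}
    (hh : Continuous h) : IntegrableOn h polarRect :=
  hh.continuousOn.integrableOn_compact (isCompact_Icc.prod isCompact_Icc)

theorem integral_pow_mul_negMulLog (n : ℕ) :
    ∫ r in (0:ℝ)..1, r ^ n * Real.negMulLog r = 1 / ((n : ℝ) + 2) ^ 2 := by
  have hn : (n : ℝ) + 2 ≠ 0 := by positivity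
  rw [intervalIntegral.integral_eq_sub_of_hasDerivAt_of_le zero_le_one
    (f := fun r => r ^ (n + 1) * Real.negMulLog r / (n + 2) + r ^ (n + 2) / ((n : ℝ) + 2) ^ 2)]
  · simp
  · exact Continuous.continuousOn (by fun_prop)
  · intro r hr
    have h1 := (((hasDerivAt_pow (n + 1) r).mul
      (Real.hasDerivAt_negMulLog hr.1.ne')).div_const ((n : ℝ) + 2)).add
      ((hasDerivAt_pow (n + 2) r).div_const (((n : ℝ) + 2) ^ 2))
    refine h1.congr_deriv ?_
    simp only [Real.negMulLog, Nat.add_sub_cancel]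
    push_cast
    field_simp
    ring
  · exact Continuous.intervalIntegrable (by fun_prop) _ _

theorem integral_exp_pow_mul_conj (m n : ℕ) :
    ∫ θ in (0:ℝ)..(2 * Real.pi), Complex.exp (θ * Complex.I) ^ m *
      (starRingEnd ℂ) (Complex.exp (θ * Complex.I) ^ n) = if m = n then 2 * (Real.pi : ℂ) else 0 := by
  have key (θ : ℝ) : Complex.exp (θ * Complex.I) ^ m *
      (starRingEnd ℂ) (Complex.exp (θ * Complex.I) ^ n) =
      Complex.exp ((((m : ℤ) - n : ℤ) * Complex.I) * θ) := by
    rw [map_pow, ← Complex.exp_conj, ← Complex.exp_nat_mul, ← Complex.exp_nat_mul,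
      ← Complex.exp_add]
    simp only [map_mul, Complex.conj_ofReal, Complex.conj_I]
    push_cast
    ring_nf
  simp only [key]
  split_ifs with h
  · subst h
    simp
  · have hc : (((m : ℤ) - n : ℤ) : ℂ) * Complex.I ≠ 0 := by
      refine mul_ne_zero (Int.cast_ne_zero.2 (sub_ne_zero.2 ?_)) Complex.I_ne_zero
      exact_mod_cast h
    rw [integral_exp_mul_complex hc]
    have : Complex.exp ((((m : ℤ) - n : ℤ) : ℂ) * Complex.I * ((2 * Real.pi : ℝ) : ℂ)) = 1 := by
      rw [← Complex.exp_int_mul_two_pi_mul_I ((m : ℤ) - n)]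
      push_cast
      ring_nf
    rw [this]
    simp

theorem setIntegral_polarRect_monomial (m n : ℕ) :
    ∫ p in polarRect, polarPt p ^ m * (starRingEnd ℂ) (polarPt p ^ n) * Real.negMulLog p.1 =
      if m = n then 2 * (Real.pi : ℂ) / (2 * ((m : ℂ) + 1)) ^ 2 else 0 := by
  have key (p : ℝ × ℝ) : polarPt p ^ m * (starRingEnd ℂ) (polarPt p ^ n) * Real.negMulLog p.1 =
      ((p.1 ^ (m + n) * Real.negMulLog p.1 : ℝ) : ℂ) * (Complex.exp (p.2 * Complex.I) ^ m *
      (starRingEnd ℂ) (Complex.exp (p.2 * Complex.I) ^ n)) := by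
    simp only [polarPt, mul_pow, map_mul, map_pow, Complex.conj_ofReal]
    push_cast
    ring
  simp only [key]
  rw [Measure.volume_eq_prod, setIntegral_prod_mul
    (fun r : ℝ => ((r ^ (m + n) * Real.negMulLog r : ℝ) : ℂ))
    (fun θ : ℝ => Complex.exp (θ * Complex.I) ^ m *
      (starRingEnd ℂ) (Complex.exp (θ * Complex.I) ^ n)), integral_Icc_eq_integral_Ioc,
    integral_Icc_eq_integral_Ioc, ← intervalIntegral.integral_of_le zero_le_one,
    ← intervalIntegral.integral_of_le Real.two_pi_pos.le, integral_exp_pow_mul_conj,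
    intervalIntegral.integral_ofReal, integral_pow_mul_negMulLog]
  split_ifs with h
  · subst h
    push_cast
    ring
  · simp

/-- The Littlewood–Paley identity for polynomials, in polar coordinates. -/
theorem integral_circle_mul_conj_eq (F G : ℂ[X]) :
    ∫ θ in (0:ℝ)..(2 * Real.pi), F.eval (Complex.exp (θ * Complex.I)) *
        (starRingEnd ℂ) (G.eval (Complex.exp (θ * Complex.I))) =
      2 * Real.pi * (F.eval 0 * (starRingEnd ℂ) (G.eval 0)) +
      4 * ∫ p in polarRect, F.derivative.eval (polarPt p) *
        (starRingEnd ℂ) (G.derivative.eval (polarPt p)) * Real.negMulLog p.1 := by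
  induction F using Polynomial.induction_on' with
  | add F₁ F₂ h₁ h₂ =>
    simp only [eval_add, derivative_add, add_mul]
    rw [intervalIntegral.integral_add, integral_add, h₁, h₂]
    · ring
    · exact integrableOn_polarRect (by fun_prop)
    · exact integrableOn_polarRect (by fun_prop)
    · exact Continuous.intervalIntegrable (by fun_prop) _ _
    · exact Continuous.intervalIntegrable (by fun_prop) _ _
  | monomial m a =>
    induction G using Polynomial.induction_on' with
    | add G₁ G₂ h₁ h₂ =>
      simp only [eval_add, map_add, mul_add, add_mul]
      rw [intervalIntegral.integral_add, integral_add, h₁, h₂]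
      · ring
      · exact integrableOn_polarRect (by fun_prop)
      · exact integrableOn_polarRect (by fun_prop)
      · exact Continuous.intervalIntegrable (by fun_prop) _ _
      · exact Continuous.intervalIntegrable (by fun_prop) _ _
    | monomial n b =>
      have e₁ (θ : ℝ) : (monomial m a).eval (Complex.exp (θ * Complex.I)) *
          (starRingEnd ℂ) ((monomial n b).eval (Complex.exp (θ * Complex.I))) =
          (a * (starRingEnd ℂ) b) * (Complex.exp (θ * Complex.I) ^ m *
            (starRingEnd ℂ) (Complex.exp (θ * Complex.I) ^ n)) := by
        simp only [eval_monomial, map_mul]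
        ring
      have e₂ (p : ℝ × ℝ) : (derivative (monomial m a)).eval (polarPt p) *
          (starRingEnd ℂ) ((derivative (monomial n b)).eval (polarPt p)) * Real.negMulLog p.1 =
          (a * (starRingEnd ℂ) b * (m * n)) * (polarPt p ^ (m - 1) *
            (starRingEnd ℂ) (polarPt p ^ (n - 1)) * Real.negMulLog p.1) := by
        simp only [derivative_monomial, eval_monomial, map_mul, map_natCast]
        ring
      simp only [e₁, e₂]
      rw [intervalIntegral.integral_const_mul, integral_const_mul, integral_exp_pow_mul_conj,
        setIntegral_polarRect_monomial]
      rcases m with _ | m <;> rcases n with _ | n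
      · simp
        ring
      · simp
      · simp
      · have hm : (m : ℂ) + 1 ≠ 0 := by exact_mod_cast m.succ_ne_zero
        by_cases h : m = n
        · subst h
          simp
          field_simp
          ring
        · simp [h]

theorem integral_circle_norm_sq_eq (F : ℂ[X]) (hF : F.eval 0 = 0) :
    ∫ θ in (0:ℝ)..(2 * Real.pi), ‖F.eval (Complex.exp (θ * Complex.I))‖ ^ 2 =
      4 * ∫ p in polarRect, ‖F.derivative.eval (polarPt p)‖ ^ 2 * Real.negMulLog p.1 := by
  have h := integral_circle_mul_conj_eq F F
  simp only [hF, zero_mul, mul_zero, zero_add, Complex.mul_conj'] at h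
  have h₁ := intervalIntegral.integral_ofReal (μ := volume) (a := 0) (b := 2 * Real.pi)
    (f := fun θ : ℝ => ‖F.eval (Complex.exp (θ * Complex.I))‖ ^ 2)
  have h₂ := integral_ofReal (𝕜 := ℂ) (μ := volume.restrict polarRect)
    (f := fun p => ‖F.derivative.eval (polarPt p)‖ ^ 2 * Real.negMulLog p.1)
  push_cast at h₁ h₂
  apply Complex.ofReal_injective
  push_cast
  exact h₁.symm.trans (h.trans (congrArg (4 * ·) h₂))

/-- The estimate for a polynomial `k`, with arbitrary positive upper bounds for the norms. -/
theorem norm_integral_circle_mul_conj_sq_le (k f g u : ℂ[X]) (hk0 : k.eval 0 = 0)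
    (hu' : u.derivative = f.derivative * g) (hu0 : u.eval 0 = 0) {A B : ℝ} (hA : 0 < A)
    (hB : 0 ≤ B) (hf : ∀ z : ℂ, ‖z‖ ≤ 1 → ‖f.eval z‖ ≤ A) (hg : ∀ z : ℂ, ‖z‖ ≤ 1 → ‖g.eval z‖ ≤ B) :
    ‖∫ θ in (0:ℝ)..(2 * Real.pi), u.eval (Complex.exp (θ * Complex.I)) *
        (starRingEnd ℂ) (k.eval (Complex.exp (θ * Complex.I)) ^ 2)‖ ≤
      8 * A * B * ∫ θ in (0:ℝ)..(2 * Real.pi), ‖k.eval (Complex.exp (θ * Complex.I))‖ ^ 2 := by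
  have hfk : (f * k).eval 0 = 0 := by simp [hk0]
  have LP₁ := integral_circle_norm_sq_eq k hk0
  have LP₂ := integral_circle_norm_sq_eq (f * k) hfk
  have LP₃ := integral_circle_mul_conj_eq u (k ^ 2)
  simp only [hu0, zero_mul, mul_zero, zero_add, eval_pow] at LP₃
  set K := ∫ θ in (0:ℝ)..(2 * Real.pi), ‖k.eval (Complex.exp (θ * Complex.I))‖ ^ 2
  have hfkK : ∫ θ in (0:ℝ)..(2 * Real.pi), ‖(f * k).eval (Complex.exp (θ * Complex.I))‖ ^ 2 ≤
      A ^ 2 * K := by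
    rw [← intervalIntegral.integral_const_mul]
    refine intervalIntegral.integral_mono_on Real.two_pi_pos.le
      (Continuous.intervalIntegrable (by fun_prop) _ _)
      (Continuous.intervalIntegrable (by fun_prop) _ _) fun θ _ => ?_
    rw [eval_mul, norm_mul, mul_pow]
    gcongr
    exact hf _ (Complex.norm_exp_ofReal_mul_I θ).le
  set I₁ := ∫ p in polarRect, ‖k.derivative.eval (polarPt p)‖ ^ 2 * Real.negMulLog p.1
  set I₂ := ∫ p in polarRect, ‖(f * k).derivative.eval (polarPt p)‖ ^ 2 * Real.negMulLog p.1
  have pointwise (p : ℝ × ℝ) (hp : p ∈ polarRect) :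
      ‖u.derivative.eval (polarPt p) * (starRingEnd ℂ) ((k ^ 2).derivative.eval (polarPt p)) *
        Real.negMulLog p.1‖ ≤
      B / A * (‖(f * k).derivative.eval (polarPt p)‖ ^ 2 * Real.negMulLog p.1) +
      3 * A * B * (‖k.derivative.eval (polarPt p)‖ ^ 2 * Real.negMulLog p.1) := by
    have hz := norm_polarPt_le hp
    have hw : 0 ≤ Real.negMulLog p.1 := Real.negMulLog_nonneg hp.1.1 hp.1.2
    have hfz := hf _ hz
    have hgz := hg _ hz
    have hu : u.derivative.eval (polarPt p) =
        f.derivative.eval (polarPt p) * g.eval (polarPt p) := by rw [hu', eval_mul]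
    have hk2 : (k ^ 2).derivative.eval (polarPt p) =
        2 * k.eval (polarPt p) * k.derivative.eval (polarPt p) := by simp [derivative_pow]
    have htri : ‖f.derivative.eval (polarPt p)‖ * ‖k.eval (polarPt p)‖ ≤
        ‖(f * k).derivative.eval (polarPt p)‖ + A * ‖k.derivative.eval (polarPt p)‖ := by
      have : f.derivative.eval (polarPt p) * k.eval (polarPt p) =
          (f * k).derivative.eval (polarPt p) -
            f.eval (polarPt p) * k.derivative.eval (polarPt p) := by simp
      rw [← norm_mul, this]
      refine (norm_sub_le _ _).trans ?_
      rw [norm_mul]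
      gcongr
    rw [hu, hk2]
    simp only [norm_mul, RCLike.norm_conj, Complex.norm_real, Complex.norm_ofNat,
      Real.norm_of_nonneg hw]
    set x := ‖(f * k).derivative.eval (polarPt p)‖
    set y := ‖k.derivative.eval (polarPt p)‖
    have hamgm : 2 * (x * y) ≤ x ^ 2 / A + A * y ^ 2 := by
      have : x ^ 2 / A + A * y ^ 2 - 2 * (x * y) = (x - A * y) ^ 2 / A := by
        field_simp
        ring
      have : 0 ≤ (x - A * y) ^ 2 / A := by positivity
      linarith
    calc ‖f.derivative.eval (polarPt p)‖ * ‖g.eval (polarPt p)‖ *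
          (2 * ‖k.eval (polarPt p)‖ * y) * Real.negMulLog p.1
        = 2 * (‖f.derivative.eval (polarPt p)‖ * ‖k.eval (polarPt p)‖) *
          ‖g.eval (polarPt p)‖ * y * Real.negMulLog p.1 := by ring
      _ ≤ 2 * (x + A * y) * B * y * Real.negMulLog p.1 := by gcongr
      _ = (2 * (x * y) + 2 * A * y ^ 2) * B * Real.negMulLog p.1 := by ring
      _ ≤ (x ^ 2 / A + A * y ^ 2 + 2 * A * y ^ 2) * B * Real.negMulLog p.1 := by gcongr
      _ = _ := by ring
  have hbound : ‖∫ p in polarRect, u.derivative.eval (polarPt p) *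
      (starRingEnd ℂ) ((k ^ 2).derivative.eval (polarPt p)) * Real.negMulLog p.1‖ ≤
      B / A * I₂ + 3 * A * B * I₁ := by
    rw [← integral_const_mul, ← integral_const_mul, ← integral_add
      (integrableOn_polarRect (by fun_prop)) (integrableOn_polarRect (by fun_prop))]
    refine (norm_integral_le_integral_norm _).trans ?_
    exact setIntegral_mono_on (integrableOn_polarRect (by fun_prop))
      (integrableOn_polarRect (by fun_prop)) (measurableSet_Icc.prod measurableSet_Icc) pointwise
  have hK : 0 ≤ K := intervalIntegral.integral_nonneg Real.two_pi_pos.le fun _ _ => by positivity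
  have hI : B / A * (4 * I₂) ≤ A * B * K := by
    rw [← LP₂]
    refine (mul_le_mul_of_nonneg_left hfkK (by positivity)).trans_eq ?_
    field_simp
  rw [LP₃, norm_mul, Complex.norm_ofNat]
  have : 0 ≤ A * B * K := by positivity
  have : 3 * A * B * (4 * I₁) = 3 * (A * B * K) := by rw [← LP₁]; ring
  linarith

theorem exists_polynomial_tendsto (s : Set ℂ) (hs : IsOpen s) (hΔ : closedDisc ⊆ s)
    (k : ℂ → ℂ) (hk : DifferentiableOn ℂ k s) :
    ∃ P : ℕ → ℂ[X], (∀ᶠ n in atTop, (P n).eval 0 = k 0) ∧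
      TendstoUniformlyOn (fun n z => (P n).eval z) k atTop closedDisc := by
  obtain ⟨δ, hδ, hsub⟩ := (isCompact_closedBall (0 : ℂ) 1).exists_cthickening_subset_open hs hΔ
  rw [cthickening_closedBall hδ.le zero_le_one] at hsub
  lift δ to NNReal using hδ.le
  have hδ' : 0 < δ := hδ
  have hps := DifferentiableOn.hasFPowerSeriesOnBall (R := δ + 1) (hk.mono hsub) (by positivity)
  set p := cauchyPowerSeries k 0 (δ + 1 : NNReal)
  have hun := hps.tendstoUniformlyOn' (r' := δ / 2 + 1) (by
    norm_cast
    gcongr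
    exact half_lt_self hδ')
  refine ⟨fun n => ∑ i ∈ Finset.range n, Polynomial.monomial i (p.coeff i), ?_, ?_⟩
  · filter_upwards [eventually_ge_atTop 1] with n hn
    rw [eval_finsetSum, Finset.sum_eq_single_of_mem 0 (Finset.mem_range.2 hn)
      fun i _ hi => by simp [hi]]
    have := hps.coeff_zero (0 : Fin 0 → ℂ)
    simp only [eval_monomial, pow_zero, mul_one]
    rw [← this]
    exact congrArg (p 0) (Subsingleton.elim _ _)
  · refine (hun.mono (s' := closedDisc) fun z hz => ?_).congr
      (Eventually.of_forall fun n z _ => ?_)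
    · rw [mem_closedBall_zero_iff] at hz
      rw [mem_ball_zero_iff]
      push_cast
      linarith
    · simp [FormalMultilinearSeries.partialSum, eval_finsetSum, mul_comm]

theorem tendsto_intervalIntegral_of_tendstoUniformly {E : Type*} [NormedAddCommGroup E]
    [NormedSpace ℝ E] {a b : ℝ} {Φ : ℝ → ℂ → E} (hΦ : Continuous (Function.uncurry Φ))
    {F : ℕ → ℝ → ℂ} (hF : ∀ n, Continuous (F n)) {φ : ℝ → ℂ} (hφ : Continuous φ)
    (h : TendstoUniformly F φ atTop) :
    Tendsto (fun n => ∫ θ in a..b, Φ θ (F n θ)) atTop (𝓝 (∫ θ in a..b, Φ θ (φ θ))) := by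
  obtain ⟨M, hM⟩ := (isCompact_uIcc (a := a) (b := b)).exists_bound_of_continuousOn hφ.continuousOn
  obtain ⟨C, hC⟩ := ((isCompact_uIcc (a := a) (b := b)).prod
    (isCompact_closedBall (0 : ℂ) (M + 1))).exists_bound_of_continuousOn hΦ.continuousOn
  refine intervalIntegral.tendsto_integral_filter_of_dominated_convergence (fun _ => C)
    (Eventually.of_forall fun n =>
      (hΦ.comp (continuous_id.prodMk (hF n))).aestronglyMeasurable) ?_ (by simp) ?_
  · filter_upwards [Metric.tendstoUniformly_iff.1 h 1 one_pos] with n hn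
    refine Eventually.of_forall fun θ hθ => hC (θ, F n θ) ⟨Set.uIoc_subset_uIcc hθ, ?_⟩
    have h₁ := hn θ
    rw [dist_comm, dist_eq_norm] at h₁
    have h₂ := norm_le_norm_add_norm_sub (φ θ) (F n θ)
    have h₃ := hM θ (Set.uIoc_subset_uIcc hθ)
    rw [norm_sub_rev] at h₂
    rw [mem_closedBall_zero_iff]
    linarith [norm_sub_rev (F n θ) (φ θ)]
  · exact Eventually.of_forall fun θ _ =>
      ((hΦ.comp (Continuous.prodMk_right θ)).tendsto (φ θ)).comp (h.tendsto_at θ)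

end

/-- Let `k` be holomorphic on an open neighbourhood of the closed unit disc
with `k(0) = 0`.  For all analytic polynomials `f, g` and `u` with `u(0) = 0`, `u' = f'g`:
`|∫_𝕋 u(z) conj(k(z)²) |dz|| ≤ 8 ‖f‖_∞ ‖g‖_∞ ∫_𝕋 |k(z)|² |dz|`. -/
theorem estimate_D_k_squared_norm (s : Set ℂ) (hs : IsOpen s) (hΔ : closedDisc ⊆ s)
    (k : ℂ → ℂ) (hk : DifferentiableOn ℂ k s) (hk0 : k 0 = 0)
    (f g u : Polynomial ℂ) (hu' : u.derivative = f.derivative * g) (hu0 : u.eval 0 = 0) :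
    ‖∫ θ in (0:ℝ)..(2 * Real.pi), u.eval (Complex.exp (θ * Complex.I)) *
        (starRingEnd ℂ) ((k (Complex.exp (θ * Complex.I))) ^ 2)‖ ≤
      8 * (⨆ z : closedDisc, ‖f.eval (z : ℂ)‖) * (⨆ z : closedDisc, ‖g.eval (z : ℂ)‖) *
        ∫ θ in (0:ℝ)..(2 * Real.pi), ‖k (Complex.exp (θ * Complex.I))‖ ^ 2 := by
  have hcont : ContinuousOn k closedDisc := hk.continuousOn.mono hΔ
  obtain ⟨P, hP0, hP⟩ := exists_polynomial_tendsto s hs hΔ k hk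
  have hbdd (q : Polynomial ℂ) : BddAbove (Set.range fun z : closedDisc => ‖q.eval (z : ℂ)‖) :=
    (isCompact_range (by fun_prop)).bddAbove
  have hle (q : Polynomial ℂ) (z : ℂ) (hz : ‖z‖ ≤ 1) :
      ‖q.eval z‖ ≤ ⨆ w : closedDisc, ‖q.eval (w : ℂ)‖ :=
    le_ciSup (hbdd q) ⟨z, mem_closedBall_zero_iff.2 hz⟩
  set A := ⨆ z : closedDisc, ‖f.eval (z : ℂ)‖
  set B := ⨆ z : closedDisc, ‖g.eval (z : ℂ)‖
  have hA : 0 ≤ A := Real.iSup_nonneg fun _ => norm_nonneg _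
  have hB : 0 ≤ B := Real.iSup_nonneg fun _ => norm_nonneg _
  have hmem (θ : ℝ) : Complex.exp (θ * Complex.I) ∈ closedDisc :=
    mem_closedBall_zero_iff.2 (Complex.norm_exp_ofReal_mul_I θ).le
  have hk_circle : Continuous fun θ : ℝ => k (Complex.exp (θ * Complex.I)) :=
    hcont.comp_continuous (by fun_prop) hmem
  have hP_circle : TendstoUniformly
      (fun n (θ : ℝ) => (P n).eval (Complex.exp (θ * Complex.I)))
      (fun θ => k (Complex.exp (θ * Complex.I))) Filter.atTop := fun v hv =>
    (hP v hv).mono fun n hn θ => hn _ (hmem θ)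
  have hL := tendsto_intervalIntegral_of_tendstoUniformly (a := 0) (b := 2 * Real.pi)
    (Φ := fun θ w => u.eval (Complex.exp (θ * Complex.I)) * (starRingEnd ℂ) (w ^ 2))
    (by fun_prop) (fun n => by fun_prop) hk_circle hP_circle
  have hR := tendsto_intervalIntegral_of_tendstoUniformly (a := 0) (b := 2 * Real.pi)
    (Φ := fun _ w => ‖w‖ ^ 2) (by fun_prop) (fun n => by fun_prop) hk_circle hP_circle
  have hpos (ε : ℝ) (hε : 0 < ε) := le_of_tendsto_of_tendsto hL.norm
    (hR.const_mul (8 * (A + ε) * B)) (hP0.mono fun n hn =>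
      norm_integral_circle_mul_conj_sq_le (P n) f g u (hn.trans hk0) hu' hu0 (by positivity) hB
        (fun z hz => (hle f z hz).trans (by linarith)) (hle g))
  have hlim : Filter.Tendsto (fun ε : ℝ => 8 * (A + ε) * B *
      ∫ θ in (0:ℝ)..(2 * Real.pi), ‖k (Complex.exp (θ * Complex.I))‖ ^ 2)
      (nhdsWithin 0 (Set.Ioi 0)) (nhds (8 * (A + 0) * B *
      ∫ θ in (0:ℝ)..(2 * Real.pi), ‖k (Complex.exp (θ * Complex.I))‖ ^ 2)) :=
    (Continuous.tendsto (by fun_prop) 0).mono_left nhdsWithin_le_nhds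
  rw [add_zero] at hlim
  exact ge_of_tendsto hlim (Filter.eventually_of_mem self_mem_nhdsWithin hpos)

end
end
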